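/- arXiv:2311.02470 — 3 statements merged into one kernel-verified Lean document; each statement's English description precedes it below -/
import Mathlib

section
/- Let n ≥ 3 be an integer and let μ, a, b, p, q be real constants with μ ≥ 0, b ≥ 0, q ≥ 1 and p ≥ −1. Assume that either (i) a·(2/(n−1) − p) ≥ 0, or (ii) 0 < p < 4/(n−1). Then there exists a constant C > 0, depending only on n and p, such that for every R > 0 and every smooth function v on ℝⁿ that is positive on the open ball B(0,R) and satisfies Δv + μ·v + a·v^{p+1} + b·v^{1−q} = 0 on B(0,R), one has |∇v(x)|²/v(x)² ≤ C/R² for every x in the ball B(0,R/2). (This is the Euclidean case κ = 0 of Theorem 1, since ℝⁿ has nonnegative Ricci curvature.) -/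
open Real

/-- The Euclidean Laplace operator: sum of second partial derivatives. -/
noncomputable def lap {n : ℕ} (v : EuclideanSpace ℝ (Fin n) → ℝ)
    (x : EuclideanSpace ℝ (Fin n)) : ℝ :=
  ∑ i, fderiv ℝ (fun y => fderiv ℝ v y (EuclideanSpace.single i 1)) x
    (EuclideanSpace.single i 1)

open scoped ContDiff Topology

/-- Partial derivative in direction `i`. -/
noncomputable def pd {n : ℕ} (i : Fin n) (g : EuclideanSpace ℝ (Fin n) → ℝ)
    (x : EuclideanSpace ℝ (Fin n)) : ℝ :=
  fderiv ℝ g x (EuclideanSpace.single i 1)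

section pdcalc
variable {n : ℕ} {g h : EuclideanSpace ℝ (Fin n) → ℝ} {x : EuclideanSpace ℝ (Fin n)}
  {U : Set (EuclideanSpace ℝ (Fin n))}

theorem pd_smooth (i : Fin n) (hg : ContDiffAt ℝ ∞ g x) : ContDiffAt ℝ ∞ (pd i g) x := by
  have : ContDiffAt ℝ ∞ (fderiv ℝ g) x := hg.fderiv_right (by simp)
  exact this.clm_apply contDiffAt_const

theorem sm_diff (hg : ContDiffAt ℝ ∞ g x) : DifferentiableAt ℝ g x :=
  hg.differentiableAt (by simp)

theorem pd_eqOn (hU : IsOpen U) (i : Fin n) (hgh : Set.EqOn g h U) :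
    Set.EqOn (pd i g) (pd i h) U := by
  intro y hy
  have : g =ᶠ[𝓝 y] h := Filter.eventuallyEq_of_mem (hU.mem_nhds hy) hgh
  simp only [pd, this.fderiv_eq]

theorem pd_add (i : Fin n) (hg : DifferentiableAt ℝ g x) (hh : DifferentiableAt ℝ h x) :
    pd i (fun y => g y + h y) x = pd i g x + pd i h x := by
  simp [pd, fderiv_fun_add hg hh]

theorem pd_mul (i : Fin n) (hg : DifferentiableAt ℝ g x) (hh : DifferentiableAt ℝ h x) :
    pd i (fun y => g y * h y) x = g x * pd i h x + h x * pd i g x := by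
  simp [pd, fderiv_fun_mul hg hh]

theorem pd_const (i : Fin n) (c : ℝ) : pd i (fun _ => c) x = 0 := by
  simp [pd]

theorem pd_neg (i : Fin n) : pd i (fun y => - g y) x = - pd i g x := by
  simp [pd]

theorem pd_sum {ι : Type*} (s : Finset ι) (G : ι → EuclideanSpace ℝ (Fin n) → ℝ) (i : Fin n)
    (hg : ∀ k ∈ s, DifferentiableAt ℝ (G k) x) :
    pd i (fun y => ∑ k ∈ s, G k y) x = ∑ k ∈ s, pd i (G k) x := by
  simp [pd, fderiv_fun_sum hg]

theorem pd_comp (i : Fin n) {φ : ℝ → ℝ} {φ' : ℝ} (hφ : HasDerivAt φ φ' (g x))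
    (hg : DifferentiableAt ℝ g x) : pd i (fun y => φ (g y)) x = φ' * pd i g x := by
  have := hφ.comp_hasFDerivAt x hg.hasFDerivAt
  have h2 : fderiv ℝ (fun y => φ (g y)) x = φ' • fderiv ℝ g x := this.fderiv
  simp [pd, h2]

theorem pd_coord (i j : Fin n) : pd i (fun y => y j) x = if i = j then 1 else 0 := by
  have : HasFDerivAt (fun y : EuclideanSpace ℝ (Fin n) => y j)
    (EuclideanSpace.proj j : EuclideanSpace ℝ (Fin n) →L[ℝ] ℝ) x :=
    (EuclideanSpace.proj j : EuclideanSpace ℝ (Fin n) →L[ℝ] ℝ).hasFDerivAt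
  rw [pd, this.fderiv]
  simp [eq_comm]

theorem pd_comm (i j : Fin n) (hg : ContDiffAt ℝ ∞ g x) : pd i (pd j g) x = pd j (pd i g) x := by
  have hs := hg.isSymmSndFDerivAt (by
    simp only [minSmoothness_of_isRCLikeNormedField]
    exact WithTop.coe_le_coe.2 (le_top : (2 : ℕ∞) ≤ ⊤))
  have hd : DifferentiableAt ℝ (fderiv ℝ g) x :=
    (hg.fderiv_right (m := 1) (by norm_cast)).differentiableAt (by simp)
  have key : ∀ i j : Fin n, pd i (pd j g) x =
      fderiv ℝ (fderiv ℝ g) x (EuclideanSpace.single i 1) (EuclideanSpace.single j 1) := by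
    intro i j
    have : fderiv ℝ (fun y => fderiv ℝ g y (EuclideanSpace.single j 1)) x = _ :=
      (hd.hasFDerivAt.clm_apply (hasFDerivAt_const _ x)).fderiv
    have e : pd j g = fun y => fderiv ℝ g y (EuclideanSpace.single j 1) := rfl
    rw [pd, e, this]
    simp
  rw [key, key]
  exact hs _ _

theorem snd_test {φ φ' : ℝ → ℝ} {φ'' : ℝ} (hm : IsLocalMax φ 0)
    (h1 : ∀ᶠ t in 𝓝 0, HasDerivAt φ (φ' t) t) (h2 : HasDerivAt φ' φ'' 0) : φ'' ≤ 0 := by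
  by_contra hc
  push Not at hc
  have e1 : deriv φ =ᶠ[𝓝 0] φ' := h1.mono fun t ht => ht.deriv
  have e2 : deriv (deriv φ) 0 = φ'' := by rw [e1.deriv_eq, h2.deriv]
  have hmin := isLocalMin_of_deriv_deriv_pos (by rw [e2]; exact hc) hm.deriv_eq_zero
    h1.self_of_nhds.continuousAt
  have ec : φ =ᶠ[𝓝 0] fun _ => φ 0 := by
    filter_upwards [hm, hmin] with t a b using le_antisymm a b
  have : deriv (deriv φ) 0 = 0 := by
    rw [ec.deriv.deriv_eq]; simp
  linarith

theorem pd_max (i : Fin n) (hm : IsLocalMax g x) : pd i g x = 0 := by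
  simp [pd, hm.fderiv_eq_zero]

theorem pd_pd_max (i : Fin n) (hm : IsLocalMax g x) (hg : ContDiffAt ℝ ∞ g x) :
    pd i (pd i g) x ≤ 0 := by
  set e : EuclideanSpace ℝ (Fin n) := EuclideanSpace.single i 1 with he
  have hl : ∀ t : ℝ, HasDerivAt (fun t : ℝ => x + t • e) e t := fun t => by
    simpa using ((hasDerivAt_id t).smul_const e).const_add x
  have hc : Filter.Tendsto (fun t : ℝ => x + t • e) (𝓝 0) (𝓝 x) := by
    have := (hl 0).continuousAt.tendsto
    simpa using this
  have hgen : ∀ (k : EuclideanSpace ℝ (Fin n) → ℝ) (t : ℝ), DifferentiableAt ℝ k (x + t • e) →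
      HasDerivAt (fun t : ℝ => k (x + t • e)) (pd i k (x + t • e)) t := fun k t hk =>
    hk.hasFDerivAt.comp_hasDerivAt t (hl t)
  refine snd_test (φ := fun t : ℝ => g (x + t • e)) (φ' := fun t => pd i g (x + t • e)) ?_ ?_ ?_
  · have : ∀ᶠ y in 𝓝 x, g y ≤ g x := hm
    have := hc.eventually this
    simpa [IsLocalMax, IsMaxFilter] using this
  · have h1 : ContDiffAt ℝ 1 g x := hg.of_le (by norm_cast)
    have h2 := h1.eventually (by simp)
    exact (hc.eventually h2).mono fun t ht => hgen g t (ht.differentiableAt (by simp))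
  · have := hgen (pd i g) 0 (by simpa using sm_diff (pd_smooth i hg))
    simpa using this

theorem norm_grad (v : EuclideanSpace ℝ (Fin n) → ℝ) : ‖gradient v x‖ ^ 2 = ∑ i, pd i v x ^ 2 := by
  rw [EuclideanSpace.real_norm_sq_eq]
  refine Finset.sum_congr rfl fun i _ => ?_
  congr 1
  have : inner ℝ (gradient v x) (EuclideanSpace.single i 1) = pd i v x := by
    simp [gradient, pd]
  rw [← this, EuclideanSpace.inner_single_right]
  simp
end pdcalc

theorem coef (k p : ℝ) (hk : 0 < k) : ∃ c : ℝ, 0 < c ∧ ∀ μ A B q f : ℝ, 0 ≤ μ → 0 ≤ B → 0 ≤ q →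
    0 ≤ f → (A * (2 * k - p) ≥ 0 ∨ (0 < p ∧ p < 4 * k)) →
    c * (f ^ 2 + (f + μ + A + B) ^ 2) ≤ k * (f + μ + A + B) ^ 2 - (p * A - q * B) * f := by
  have case1 : ∀ μ A B q f : ℝ, 0 ≤ μ → 0 ≤ B → 0 ≤ q →
    0 ≤ f → A * (2 * k - p) ≥ 0 →
    k / 3 * (f ^ 2 + (f + μ + A + B) ^ 2) ≤ k * (f + μ + A + B) ^ 2 - (p * A - q * B) * f := by
    intro μ A B q f hμ hB hq hf h
    have h1 : 0 ≤ k * (f - (μ + A + B)) ^ 2 := by positivity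
    have h2 : 0 ≤ A * (2 * k - p) * f := mul_nonneg h hf
    have h3 : 0 ≤ k * f * μ := by positivity
    have h4 : 0 ≤ k * f * B := by positivity
    have h5 : 0 ≤ q * B * f := by positivity
    have h6 : 0 ≤ k * (μ + A + B) ^ 2 := by positivity
    nlinarith
  by_cases hp : 0 < p ∧ p < 4 * k
  · obtain ⟨hp0, hp4⟩ := hp
    have hd : 0 < p * (4 * k - p) / 4 / (k + p) := by
      have : 0 < 4 * k - p := by linarith
      positivity
    set c := p * (4 * k - p) / 4 / (k + p) with hc
    have hce : c * (k + p) = p * (4 * k - p) / 4 := by rw [hc]; field_simp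
    have hck : c < k := by
      by_contra h
      push Not at h
      nlinarith
    have case2 : ∀ μ A B q f : ℝ, 0 ≤ μ → 0 ≤ B → 0 ≤ q → 0 ≤ f → 
      c * (f ^ 2 + (f + μ + A + B) ^ 2) ≤ k * (f + μ + A + B) ^ 2 - (p * A - q * B) * f := by
      intro μ A B q f hμ hB hq hf
      obtain ⟨S, hS⟩ : ∃ S, S = f + μ + A + B := ⟨_, rfl⟩
      have hA : A = S - f - μ - B := by linarith
      rw [← hS, hA]
      have h1 : 0 ≤ p * μ * f := by positivity
      have h2 : 0 ≤ (p + q) * B * f := by positivity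
      have h3 : 0 ≤ (k - c) * S ^ 2 - p * f * S + (p - c) * f ^ 2 := by
        have : 0 ≤ (k - c) * ((k - c) * S ^ 2 - p * f * S + (p - c) * f ^ 2) := by
          have e : (k - c) * ((k - c) * S ^ 2 - p * f * S + (p - c) * f ^ 2) =
            ((k - c) * S - p * f / 2) ^ 2 + c ^ 2 * f ^ 2 := by
            linear_combination (-f^2) * hce
          rw [e]; positivity
        exact nonneg_of_mul_nonneg_right this (by linarith)
      nlinarith
    refine ⟨min (k / 3) c, by positivity, ?_⟩
    intro μ A B q f hμ hB hq hf h
    have hn : 0 ≤ f ^ 2 + (f + μ + A + B) ^ 2 := by positivity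
    exact (mul_le_mul_of_nonneg_right (min_le_right _ _) hn).trans (case2 μ A B q f hμ hB hq hf)
  · refine ⟨k / 3, by positivity, ?_⟩
    intro μ A B q f hμ hB hq hf h
    exact case1 μ A B q f hμ hB hq hf (h.resolve_right hp)

/-- Refined Cauchy-Schwarz for the Hessian. -/
theorem hess {n : ℕ} (hn : 3 ≤ n) (H : Fin n → Fin n → ℝ) (w : Fin n → ℝ) (f S m : ℝ)
    (hf : 0 < f) (hw : ∑ i, w i ^ 2 = f) (htr : ∑ i, H i i = -S)
    (hm : ∑ j, ∑ i, w j * (w i * H i j) = f * m) :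
    1 / ((n : ℝ) - 1) * (S + m) ^ 2 ≤ ∑ j, ∑ i, H i j ^ 2 := by
  have hn' : (3 : ℝ) ≤ n := by exact_mod_cast hn
  have hn0 : (n : ℝ) - 1 ≠ 0 := by linarith
  set α := -(S + m) / ((n : ℝ) - 1) with hα
  have hαe : ((n : ℝ) - 1) * α = -(S + m) := by rw [hα]; field_simp
  set β := (m - α) / f with hβ
  have hβe : β * f = m - α := by rw [hβ]; field_simp
  have h0 : 0 ≤ ∑ j, ∑ i, (H i j - α * (if i = j then 1 else 0) - β * (w i * w j)) ^ 2 :=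
    Finset.sum_nonneg fun j _ => Finset.sum_nonneg fun i _ => sq_nonneg _
  have e : ∑ j, ∑ i, (H i j - α * (if i = j then 1 else 0) - β * (w i * w j)) ^ 2 =
      ∑ j, ∑ i, H i j ^ 2 - 2 * α * ∑ i, H i i - 2 * β * ∑ j, ∑ i, w j * (w i * H i j)
      + n * α ^ 2 + β ^ 2 * ((∑ i, w i ^ 2) * (∑ i, w i ^ 2)) + 2 * α * β * ∑ i, w i ^ 2 := by
    have h1 : ∀ i j : Fin n, (H i j - α * (if i = j then 1 else 0) - β * (w i * w j)) ^ 2 =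
      H i j ^ 2 - (if i = j then 2 * α * H i j else 0) - 2 * β * (w j * (w i * H i j)) +
      (if i = j then α ^ 2 else 0) + β ^ 2 * (w i ^ 2 * w j ^ 2) +
      (if i = j then 2 * α * β * (w i * w j) else 0) := by
      intro i j
      split_ifs <;> ring
    simp only [h1, Finset.sum_add_distrib, Finset.sum_sub_distrib]
    simp only [Finset.sum_ite_eq', Finset.mem_univ, if_true, ← Finset.mul_sum, ← Finset.sum_mul]
    simp [pow_two, Finset.mul_sum]
  rw [e, hw, htr, hm] at h0
  have hg : 1 / ((n : ℝ) - 1) * (S + m) ^ 2 = ((n : ℝ) - 1) * α ^ 2 := by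
    rw [hα]; field_simp
  rw [hg]
  have e2 : - 2 * α * (-S) - 2 * β * (f * m) + n * α ^ 2 + β ^ 2 * (f * f) + 2 * α * β * f
    = - ((n : ℝ) - 1) * α ^ 2 - m ^ 2 := by
    linear_combination (β * f - 2 * m + 2 * α + (m - α)) * hβe + (2 * α) * hαe
  nlinarith [sq_nonneg m]

theorem alg (n c k f η r m S L X D : ℝ) (hn : 0 ≤ n) (hc : 0 < c) (hf : 0 < f) (hη : 0 ≤ η)
    (hX : X ≤ r ^ 2) (hηr : η ≤ r ^ 2)
    (h : η ^ 2 * (2 * (L - 2 * f * m - D * f)) - 32 * X * f + 2 * (4 * X - 2 * n * η) * f ≤ 0)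
    (hL : k * (S + m) ^ 2 ≤ L) (hk : 0 ≤ k) (hcS : c * (f ^ 2 + S ^ 2) ≤ k * S ^ 2 - D * f)
    (hm : η ^ 2 * m ^ 2 ≤ 4 * r ^ 2 * f) :
    η ^ 2 * f ≤ (2 / c) * (12 + 2 * n + (4 * k ^ 2 + 8) / c) * r ^ 2 := by
  have h1 : c * f ^ 2 - k ^ 2 / c * m ^ 2 ≤ L - D * f := by
    have : 0 ≤ c * (S + k / c * m) ^ 2 := by positivity
    have e : c * (S + k / c * m) ^ 2 = c * S ^ 2 + 2 * k * S * m + k ^ 2 / c * m ^ 2 := by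
      field_simp; ring
    have h2 : 0 ≤ k * m ^ 2 := by positivity
    nlinarith
  have h2 : 2 * f * m ≤ c / 2 * f ^ 2 + 2 / c * m ^ 2 := by
    have : 0 ≤ c / 2 * (f - 2 / c * m) ^ 2 := by positivity
    have e : c / 2 * (f - 2 / c * m) ^ 2 = c / 2 * f ^ 2 - 2 * f * m + 2 / c * m ^ 2 := by
      field_simp; ring
    linarith
  have h3 : c / 2 * f ^ 2 - (k ^ 2 + 2) / c * m ^ 2 ≤ L - 2 * f * m - D * f := by
    have : (k ^ 2 + 2) / c * m ^ 2 = k ^ 2 / c * m ^ 2 + 2 / c * m ^ 2 := by ring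
    linarith
  have h4 := mul_le_mul_of_nonneg_left h3 (sq_nonneg η)
  have h5 : (k ^ 2 + 2) / c * (η ^ 2 * m ^ 2) ≤ (k ^ 2 + 2) / c * (4 * r ^ 2 * f) :=
    mul_le_mul_of_nonneg_left hm (by positivity)
  have h6 : X * f ≤ r ^ 2 * f := mul_le_mul_of_nonneg_right hX hf.le
  have h7 : n * η * f ≤ n * r ^ 2 * f :=
    mul_le_mul_of_nonneg_right (mul_le_mul_of_nonneg_left hηr hn) hf.le
  have h8 : f * (c / 2 * (η ^ 2 * f)) ≤ f * ((12 + 2 * n + (4 * k ^ 2 + 8) / c) * r ^ 2) := by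
    have e : (4 * k ^ 2 + 8) / c = 4 * ((k ^ 2 + 2) / c) := by ring
    rw [e]
    nlinarith
  have h9 := le_of_mul_le_mul_left h8 hf
  have h10 := mul_le_mul_of_nonneg_left h9 (by positivity : 0 ≤ 2 / c)
  have e : 2 / c * (c / 2 * (η ^ 2 * f)) = η ^ 2 * f := by field_simp
  rw [e] at h10
  linarith

theorem bochner {n : ℕ} (hn : 3 ≤ n) (U : Set (EuclideanSpace ℝ (Fin n))) (hU : IsOpen U)
    (w : EuclideanSpace ℝ (Fin n) → ℝ) (hw : ∀ x ∈ U, ContDiffAt ℝ ∞ w x)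
    (μ a b p q c r : ℝ) (hμ : 0 ≤ μ) (hb : 0 ≤ b) (hq : 0 ≤ q) (hc : 0 < c)
    (hcoef : ∀ μ A B q f : ℝ, 0 ≤ μ → 0 ≤ B → 0 ≤ q →
      0 ≤ f → (A * (2 * (1 / ((n : ℝ) - 1)) - p) ≥ 0 ∨ (0 < p ∧ p < 4 * (1 / ((n : ℝ) - 1)))) →
      c * (f ^ 2 + (f + μ + A + B) ^ 2) ≤
        1 / ((n : ℝ) - 1) * (f + μ + A + B) ^ 2 - (p * A - q * B) * f)
    (hab : a * (2 * (1 / ((n : ℝ) - 1)) - p) ≥ 0 ∨ (0 < p ∧ p < 4 * (1 / ((n : ℝ) - 1))))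
    (heq : ∀ x ∈ U, ∑ i, pd i (pd i w) x =
      -(∑ i, pd i w x * pd i w x + μ + a * exp (p * w x) + b * exp (-q * w x)))
    (x : EuclideanSpace ℝ (Fin n)) (hx : x ∈ U)
    (hmax : IsLocalMax (fun y : EuclideanSpace ℝ (Fin n) => (r ^ 2 + -∑ i, y i * y i) *
      (r ^ 2 + -∑ i, y i * y i) * ∑ i, pd i w y * pd i w y) x)
    (hη : 0 < r ^ 2 + -∑ i, x i * x i) (hf : 0 < ∑ i, pd i w x * pd i w x) :
    (r ^ 2 + -∑ i, x i * x i) * (r ^ 2 + -∑ i, x i * x i) * ∑ i, pd i w x * pd i w x ≤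
      (2 / c) * (12 + 2 * n + (4 * (1 / ((n : ℝ) - 1)) ^ 2 + 8) / c) * r ^ 2 := by
  -- smoothness
  have s1 : ∀ i, ∀ y ∈ U, ContDiffAt ℝ ∞ (pd i w) y := fun i y hy => pd_smooth i (hw y hy)
  have s2 : ∀ i j, ∀ y ∈ U, ContDiffAt ℝ ∞ (pd j (pd i w)) y :=
    fun i j y hy => pd_smooth j (s1 i y hy)
  set f : EuclideanSpace ℝ (Fin n) → ℝ := fun y => ∑ i, pd i w y * pd i w y with hfdef
  set η : EuclideanSpace ℝ (Fin n) → ℝ := fun y => r ^ 2 + -∑ i, y i * y i with hηdef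
  have sf : ∀ y ∈ U, ContDiffAt ℝ ∞ f y := fun y hy =>
    ContDiffAt.sum fun i _ => (s1 i y hy).mul (s1 i y hy)
  have sco : ∀ i y, ContDiffAt ℝ ∞ (fun y : EuclideanSpace ℝ (Fin n) => y i) y := fun i y =>
    (EuclideanSpace.proj i : EuclideanSpace ℝ (Fin n) →L[ℝ] ℝ).contDiff.contDiffAt
  have sη : ∀ y, ContDiffAt ℝ ∞ η y := fun y =>
    contDiffAt_const.add (ContDiffAt.sum fun i _ => (sco i y).mul (sco i y)).neg
  -- derivatives of η
  have dη : ∀ j y, pd j η y = -2 * y j := by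
    intro j y
    have hsq : ContDiffAt ℝ ∞ (fun y : EuclideanSpace ℝ (Fin n) => ∑ i, y i * y i) y :=
      ContDiffAt.sum fun i _ => (sco i y).mul (sco i y)
    rw [hηdef, pd_add j (by fun_prop) (sm_diff hsq.neg), pd_const, pd_neg,
      pd_sum _ (fun (i : Fin n) (y : EuclideanSpace ℝ (Fin n)) => y i * y i) j
        (fun i _ => sm_diff ((sco i y).mul (sco i y)))]
    have : ∀ i, pd j (fun y : EuclideanSpace ℝ (Fin n) => y i * y i) y =
        if j = i then 2 * y i else 0 := by
      intro i
      rw [pd_mul j (sm_diff (sco i y)) (sm_diff (sco i y)), pd_coord]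
      split_ifs <;> ring
    simp [this]
  have ddη : ∀ j y, pd j (pd j η) y = -2 := by
    intro j y
    have : pd j η = fun y => (-2 : ℝ) * y j := funext (dη j)
    rw [this, pd_mul j (by fun_prop) (sm_diff (sco j y)), pd_coord, pd_const]
    simp
  -- derivatives of f
  have df : ∀ j, ∀ y ∈ U, pd j f y = ∑ i, 2 * (pd i w y * pd j (pd i w) y) := by
    intro j y hy
    rw [hfdef, pd_sum _ (fun (i : Fin n) y => pd i w y * pd i w y) j
      (fun i _ => sm_diff ((s1 i y hy).mul (s1 i y hy)))]
    refine Finset.sum_congr rfl fun i _ => ?_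
    rw [pd_mul j (sm_diff (s1 i y hy)) (sm_diff (s1 i y hy))]; ring
  have ddf : ∀ j, pd j (pd j f) x =
      ∑ i, 2 * (pd j (pd i w) x ^ 2 + pd i w x * pd j (pd j (pd i w)) x) := by
    intro j
    rw [pd_eqOn hU j (df j) hx, pd_sum _ (fun (i : Fin n) y => 2 * (pd i w y * pd j (pd i w) y)) j
      (fun i _ => sm_diff (contDiffAt_const.mul ((s1 i x hx).mul (s2 i j x hx))))]
    refine Finset.sum_congr rfl fun i _ => ?_
    rw [pd_mul j (by fun_prop) (sm_diff ((s1 i x hx).mul (s2 i j x hx))), pd_const,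
      pd_mul j (sm_diff (s1 i x hx)) (sm_diff (s2 i j x hx))]
    ring
  -- the differentiated equation
  set A := a * exp (p * w x) with hA
  set B := b * exp (-q * w x) with hB
  have dT : ∀ i, ∑ j, pd j (pd j (pd i w)) x = -(pd i f x + (p * A - q * B) * pd i w x) := by
    intro i
    have h1 : ∀ j, pd j (pd j (pd i w)) x = pd i (pd j (pd j w)) x := by
      intro j
      rw [pd_eqOn hU j (fun y hy => pd_comm j i (hw y hy)) hx, pd_comm j i (s1 j x hx)]
    simp only [h1]
    rw [← pd_sum _ (fun (j : Fin n) => pd j (pd j w)) i (fun j _ => sm_diff (s2 j j x hx)),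
      pd_eqOn hU i heq hx]
    have he : ∀ s t : ℝ, ContDiffAt ℝ ∞ (fun y => s * exp (t * w y)) x := fun s t =>
      contDiffAt_const.mul (contDiffAt_const.mul (hw x hx)).exp
    have hde : ∀ s t : ℝ, pd i (fun y => s * exp (t * w y)) x =
        s * t * exp (t * w x) * pd i w x := by
      intro s t
      refine pd_comp (φ := fun z => s * exp (t * z)) i ?_ (sm_diff (hw x hx))
      have := (((hasDerivAt_id (w x)).const_mul t).exp).const_mul s
      refine this.congr_deriv ?_
      simp only [id]; ring
    rw [pd_neg, pd_add i (sm_diff (((sf x hx).add contDiffAt_const).add (he a p)))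
      (sm_diff (he b (-q))), pd_add i (sm_diff ((sf x hx).add contDiffAt_const)) (sm_diff (he a p)),
      pd_add i (sm_diff (sf x hx)) (by fun_prop), pd_const, hde, hde, hA, hB]
    ring
  -- first and second order conditions
  have sηη : ∀ y, ContDiffAt ℝ ∞ (fun y => η y * η y) y := fun y => (sη y).mul (sη y)
  have dF : ∀ j, ∀ y ∈ U, pd j (fun y => η y * η y * f y) y =
      η y * η y * pd j f y + f y * (2 * (η y * pd j η y)) := by
    intro j y hy
    rw [pd_mul j (sm_diff (sηη y)) (sm_diff (sf y hy)), pd_mul j (sm_diff (sη y)) (sm_diff (sη y))]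
    ring
  have ddF : ∀ j, pd j (pd j (fun y => η y * η y * f y)) x =
      η x ^ 2 * pd j (pd j f) x - 8 * (η x * x j * pd j f x) + 
        (8 * (x j * x j) - 4 * η x) * f x := by
    intro j
    have sη1 := pd_smooth j (sη x)
    have sf1 := pd_smooth j (sf x hx)
    have t1 : ContDiffAt ℝ ∞ (fun y => η y * pd j η y) x := (sη x).mul sη1
    have t2 : ContDiffAt ℝ ∞ (fun y => 2 * (η y * pd j η y)) x := contDiffAt_const.mul t1
    rw [pd_eqOn hU j (dF j) hx, pd_add j (sm_diff ((sηη x).mul sf1))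
      (sm_diff ((sf x hx).mul t2)), pd_mul j (sm_diff (sηη x)) (sm_diff sf1),
      pd_mul j (sm_diff (sη x)) (sm_diff (sη x)), pd_mul j (sm_diff (sf x hx)) (sm_diff t2),
      pd_mul j (by fun_prop) (sm_diff t1), pd_const, pd_mul j (sm_diff (sη x)) (sm_diff sη1),
      ddη, dη]
    ring
  have sF : ContDiffAt ℝ ∞ (fun y => η y * η y * f y) x := (sηη x).mul (sf x hx)
  have F1 : ∀ j, η x * pd j f x = 4 * (x j * f x) := by
    intro j
    have h0 := pd_max j hmax
    have h1 := dF j x hx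
    rw [h0, dη] at h1
    have : η x * (η x * pd j f x - 4 * (x j * f x)) = 0 := by linarith
    rcases mul_eq_zero.mp this with h | h
    · exact absurd h hη.ne'
    · linarith
  have F2 : ∑ j, pd j (pd j (fun y => η y * η y * f y)) x ≤ 0 :=
    Finset.sum_nonpos fun j _ => pd_pd_max j hmax sF
  -- contraction
  set X := ∑ j, x j * x j with hX
  set L := ∑ j, ∑ i, pd j (pd i w) x ^ 2 with hL
  obtain ⟨m, hm⟩ : ∃ m, ∑ j, pd j w x * pd j f x = 2 * f x * m :=
    ⟨(∑ j, pd j w x * pd j f x) / (2 * f x), by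
      have : f x ≠ 0 := hf.ne'
      field_simp⟩
  have hlapf : ∑ j, pd j (pd j f) x = 2 * (L - 2 * f x * m - (p * A - q * B) * f x) := by
    have e1 : ∑ j, pd j (pd j f) x = 2 * L + 2 * ∑ i, pd i w x * ∑ j, pd j (pd j (pd i w)) x := by
      simp only [ddf, mul_add, Finset.sum_add_distrib, hL, Finset.mul_sum]
      congr 1
      rw [Finset.sum_comm]
    have e2 : ∑ i, pd i w x * ∑ j, pd j (pd j (pd i w)) x =
        -(∑ j, pd j w x * pd j f x) - (p * A - q * B) * f x := by
      simp only [dT, hfdef, Finset.mul_sum]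
      rw [← Finset.sum_neg_distrib, ← Finset.sum_sub_distrib]
      refine Finset.sum_congr rfl fun i _ => ?_
      ring
    rw [e1, e2, hm]; ring
  have hxf : ∑ j, η x * x j * pd j f x = 4 * X * f x := by
    have e : 4 * X * f x = ∑ j, 4 * (x j * x j) * f x := by
      rw [← Finset.sum_mul, ← Finset.mul_sum]
    rw [e]
    refine Finset.sum_congr rfl fun j _ => ?_
    linear_combination x j * F1 j
  have H : η x ^ 2 * (2 * (L - 2 * f x * m - (p * A - q * B) * f x)) - 32 * X * f x +
      2 * (4 * X - 2 * n * η x) * f x ≤ 0 := by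
    have e : ∑ j, pd j (pd j (fun y => η y * η y * f y)) x =
        η x ^ 2 * ∑ j, pd j (pd j f) x - 8 * ∑ j, η x * x j * pd j f x +
        (8 * X - 4 * n * η x) * f x := by
      simp only [ddF, Finset.sum_add_distrib, Finset.sum_sub_distrib, ← Finset.mul_sum,
        ← Finset.sum_mul]
      simp only [Finset.sum_const, Finset.card_univ, Fintype.card_fin, nsmul_eq_mul]; ring
    rw [e, hlapf, hxf] at F2
    linarith
  have hmx : η x * m = 2 * ∑ j, x j * pd j w x := by
    have : 2 * f x * (η x * m) = 2 * f x * (2 * ∑ j, x j * pd j w x) := by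
      calc 2 * f x * (η x * m) = η x * (2 * f x * m) := by ring
        _ = η x * ∑ j, pd j w x * pd j f x := by rw [hm]
        _ = _ := by
          simp only [Finset.mul_sum]
          refine Finset.sum_congr rfl fun j _ => ?_
          linear_combination pd j w x * F1 j
    exact mul_left_cancel₀ (by positivity) this
  have hX0 : 0 ≤ X := Finset.sum_nonneg fun j _ => mul_self_nonneg _
  have hXr : X ≤ r ^ 2 := by
    have : 0 < r ^ 2 + -X := hη
    linarith
  have hηx : η x = r ^ 2 + -X := rfl
  have hm2 : η x ^ 2 * m ^ 2 ≤ 4 * r ^ 2 * f x := by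
    have cs := Finset.sum_mul_sq_le_sq_mul_sq Finset.univ (fun j => x j) (fun j => pd j w x)
    have e1 : ∑ j, x j ^ 2 = X := by simp only [hX, pow_two]
    have e2 : ∑ j, pd j w x ^ 2 = f x := by simp only [hfdef, pow_two]
    rw [e1, e2] at cs
    have : X * f x ≤ r ^ 2 * f x := mul_le_mul_of_nonneg_right hXr hf.le
    calc η x ^ 2 * m ^ 2 = (η x * m) ^ 2 := by ring
      _ = 4 * (∑ j, x j * pd j w x) ^ 2 := by rw [hmx]; ring
      _ ≤ _ := by linarith
  have hn' : (3 : ℝ) ≤ n := by exact_mod_cast hn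
  have hk : 0 ≤ 1 / ((n : ℝ) - 1) := by
    have : 0 < (n : ℝ) - 1 := by linarith
    positivity
  have hHess := hess hn (fun i j => pd j (pd i w) x) (fun i => pd i w x) (f x)
    (f x + μ + A + B) m hf (by simp only [hfdef, pow_two]) (heq x hx) (by
      have : ∑ j, pd j w x * pd j f x = 2 * ∑ j, ∑ i, pd j w x * (pd i w x * pd j (pd i w) x) := by
        simp only [Finset.mul_sum]
        refine Finset.sum_congr rfl fun j _ => ?_
        rw [df j x hx, Finset.mul_sum]
        refine Finset.sum_congr rfl fun i _ => ?_
        ring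
      linarith)
  have hco := hcoef μ A B q (f x) hμ (by positivity) hq hf.le (by
    rcases hab with h | h
    · left
      have := mul_nonneg h (exp_pos (p * w x)).le
      rw [hA]; linarith
    · exact Or.inr h)
  have := alg n c (1 / ((n : ℝ) - 1)) (f x) (η x) r m (f x + μ + A + B) L X (p * A - q * B)
    (by positivity) hc hf hη.le hXr (by linarith) H hHess hk hco hm2
  calc η x * η x * f x = η x ^ 2 * f x := by ring
    _ ≤ _ := this

theorem stmt_0 (n : ℕ) (hn : 3 ≤ n) (p : ℝ) (hp : -1 ≤ p) :
    ∃ C : ℝ, 0 < C ∧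
      ∀ μ a b q : ℝ, 0 ≤ μ → 0 ≤ b → 1 ≤ q →
        (a * (2 / ((n : ℝ) - 1) - p) ≥ 0 ∨ (0 < p ∧ p < 4 / ((n : ℝ) - 1))) →
        ∀ R : ℝ, 0 < R →
          ∀ v : EuclideanSpace ℝ (Fin n) → ℝ, ContDiff ℝ (⊤ : ℕ∞) v →
            (∀ x ∈ Metric.ball (0 : EuclideanSpace ℝ (Fin n)) R, 0 < v x) →
            (∀ x ∈ Metric.ball (0 : EuclideanSpace ℝ (Fin n)) R,
              lap v x + μ * v x + a * v x ^ (p + 1) + b * v x ^ (1 - q) = 0) →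
            ∀ x ∈ Metric.ball (0 : EuclideanSpace ℝ (Fin n)) (R / 2),
              ‖gradient v x‖ ^ 2 / (v x) ^ 2 ≤ C / R ^ 2 := by
  have hn' : (3 : ℝ) ≤ n := by exact_mod_cast hn
  have hk : 0 < 1 / ((n : ℝ) - 1) := by
    have : 0 < (n : ℝ) - 1 := by linarith
    positivity
  obtain ⟨c, hc, hcoef⟩ := coef (1 / ((n : ℝ) - 1)) p hk
  set K := (2 / c) * (12 + 2 * n + (4 * (1 / ((n : ℝ) - 1)) ^ 2 + 8) / c) with hK
  have hK0 : 0 < K := by positivity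
  refine ⟨144 / 25 * K, by positivity, ?_⟩
  intro μ a b q hμ hb hq hab R hR v hv hpos hpde x hx
  set U := Metric.ball (0 : EuclideanSpace ℝ (Fin n)) R with hUdef
  have hU : IsOpen U := Metric.isOpen_ball
  set w : EuclideanSpace ℝ (Fin n) → ℝ := fun y => log (v y) with hwdef
  have sv : ∀ y, ContDiffAt ℝ ∞ v y := fun y => hv.contDiffAt
  have hw : ∀ y ∈ U, ContDiffAt ℝ ∞ w y := fun y hy => (sv y).log (hpos y hy).ne'
  have dw : ∀ i, ∀ y ∈ U, pd i w y = (v y)⁻¹ * pd i v y := fun i y hy =>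
    pd_comp i (hasDerivAt_log (hpos y hy).ne') (sm_diff (sv y))
  have ddw : ∀ i, ∀ y ∈ U, pd i (pd i w) y =
      (v y)⁻¹ * pd i (pd i v) y - pd i w y * pd i w y := by
    intro i y hy
    have hvy := (hpos y hy).ne'
    have si : ContDiffAt ℝ ∞ (fun y => (v y)⁻¹) y := (sv y).inv hvy
    rw [pd_eqOn hU i (dw i) hy, pd_mul i (sm_diff si) (sm_diff (pd_smooth i (sv y))),
      pd_comp i (hasDerivAt_inv hvy) (sm_diff (sv y)), dw i y hy]
    field_simp
    ring
  have heq : ∀ y ∈ U, ∑ i, pd i (pd i w) y =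
      -(∑ i, pd i w y * pd i w y + μ + a * exp (p * w y) + b * exp (-q * w y)) := by
    intro y hy
    have hvy := hpos y hy
    rw [Finset.sum_congr rfl fun i _ => ddw i y hy, Finset.sum_sub_distrib, ← Finset.mul_sum]
    have hl : ∑ i, pd i (pd i v) y = lap v y := rfl
    have h1 := hpde y hy
    have e1 : v y ^ (p + 1) = v y * exp (p * w y) := by
      rw [rpow_add hvy, rpow_one, rpow_def_of_pos hvy, mul_comm p, mul_comm]
    have e2 : v y ^ (1 - q) = v y * exp (-q * w y) := by
      rw [sub_eq_add_neg, rpow_add hvy, rpow_one, rpow_def_of_pos hvy, mul_comm (-q)]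
    rw [e1, e2] at h1
    have h2 : lap v y = - (v y * (μ + a * exp (p * w y) + b * exp (-q * w y))) := by linarith
    rw [hl, h2]
    field_simp
    ring
  have hfx : ∀ y ∈ U, ‖gradient v y‖ ^ 2 / (v y) ^ 2 = ∑ i, pd i w y * pd i w y := by
    intro y hy
    have hvy := (hpos y hy).ne'
    rw [norm_grad, Finset.sum_div]
    refine Finset.sum_congr rfl fun i _ => ?_
    rw [dw i y hy]; field_simp
  set r := 3 / 4 * R with hr
  have hr0 : 0 < r := by positivity
  have hnorm : ∀ y : EuclideanSpace ℝ (Fin n), ∑ i, y i * y i = ‖y‖ ^ 2 := by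
    intro y
    rw [EuclideanSpace.real_norm_sq_eq]; simp only [pow_two]
  set F : EuclideanSpace ℝ (Fin n) → ℝ := fun y => (r ^ 2 + -∑ i, y i * y i) *
      (r ^ 2 + -∑ i, y i * y i) * ∑ i, pd i w y * pd i w y with hF
  have hsub : Metric.closedBall (0 : EuclideanSpace ℝ (Fin n)) r ⊆ U :=
    Metric.closedBall_subset_ball (by linarith)
  have hcF : ContinuousOn F (Metric.closedBall 0 r) := by
    intro y hy
    have hyU := hsub hy
    have s1 : ∀ i, ContinuousAt (pd i w) y := fun i => (pd_smooth i (hw y hyU)).continuousAt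
    have s2 : ContinuousAt (fun y => ∑ i, pd i w y * pd i w y) y :=
      tendsto_finsetSum _ fun i _ => (s1 i).mul (s1 i)
    have s3 : ContinuousAt (fun y : EuclideanSpace ℝ (Fin n) => r ^ 2 + -∑ i, y i * y i) y := by
      fun_prop
    exact ((s3.mul s3).mul s2).continuousWithinAt
  obtain ⟨z, hz, hzmax⟩ := (isCompact_closedBall (0 : EuclideanSpace ℝ (Fin n)) r).exists_isMaxOn
    ⟨0, by simp [hr0.le]⟩ hcF
  have hf0 : ∀ y, 0 ≤ ∑ i, pd i w y * pd i w y := fun y =>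
    Finset.sum_nonneg fun i _ => mul_self_nonneg _
  have hFz : F z ≤ K * r ^ 2 := by
    by_contra hcon
    push Not at hcon
    have hFpos : 0 < F z := lt_of_le_of_lt (by positivity) hcon
    have hzr : ‖z‖ ≤ r := by simpa using hz
    have hη0 : 0 ≤ r ^ 2 + -∑ i, z i * z i := by
      rw [hnorm]; nlinarith [norm_nonneg z]
    have hη : 0 < r ^ 2 + -∑ i, z i * z i := by
      refine lt_of_le_of_ne hη0 fun h => ?_
      simp [hF, ← h] at hFpos
    have hf : 0 < ∑ i, pd i w z * pd i w z := by
      refine lt_of_le_of_ne (hf0 z) fun h => ?_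
      simp only [hF, ← h, mul_zero, lt_irrefl] at hFpos
    have hzlt : ‖z‖ < r := by
      rw [hnorm] at hη
      nlinarith [norm_nonneg z]
    have hmax : IsLocalMax F z :=
      hzmax.isLocalMax (Metric.closedBall_mem_nhds_of_mem (by simpa using hzlt))
    have := bochner hn U hU w hw μ a b p q c r hμ hb (by linarith) hc hcoef (by
      rcases hab with h | ⟨h1, h2⟩
      · left; rw [mul_one_div]; exact h
      · right; rw [mul_one_div]; exact ⟨h1, h2⟩) heq z (hsub hz) hmax hη hf
    exact absurd hcon (not_lt.mpr this)
  have hxR : ‖x‖ < R / 2 := by simpa using hx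
  have hxU : x ∈ U := by simp [hUdef]; linarith
  have hFx : F x ≤ K * r ^ 2 := (hzmax (by simp; linarith)).trans hFz
  rw [hfx x hxU]
  set f := ∑ i, pd i w x * pd i w x with hfd
  have hηx : 5 / 16 * R ^ 2 ≤ r ^ 2 + -∑ i, x i * x i := by
    rw [hnorm, hr]; nlinarith [norm_nonneg x]
  have h1 : (5 / 16 * R ^ 2) * (5 / 16 * R ^ 2) * f ≤ K * r ^ 2 := by
    refine le_trans ?_ hFx
    have := hf0 x
    have h0 : 0 ≤ 5 / 16 * R ^ 2 := by positivity
    exact mul_le_mul_of_nonneg_right (mul_self_le_mul_self h0 hηx) this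
  rw [le_div_iff₀ (by positivity)]
  have h2 : R ^ 2 * (f * R ^ 2) ≤ R ^ 2 * (144 / 25 * K) := by
    rw [hr] at h1; nlinarith
  exact le_of_mul_le_mul_left h2 (by positivity)
end

section
/- Let n ≥ 3 be an integer and let μ, a, b, p, q be real constants with μ ≥ 0, a < 0, b ≥ 0, q ≥ 1, p > 0 and b + μ ≠ 0. Assume moreover that either a·(2/(n−1) − p) ≥ 0 or 0 < p < 4/(n−1). Then every smooth function v : ℝⁿ → ℝ with v > 0 everywhere satisfying Δv + μ·v + a·v^{p+1} + b·v^{1−q} = 0 on all of ℝⁿ is a constant function. (This is the Euclidean case of the constancy assertion in Corollary 1.) -/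
open Real

lemma second_test (g g' : ℝ → ℝ) (d : ℝ) (hg : ∀ᶠ t in nhds 0, HasDerivAt g (g' t) t)
    (hd : HasDerivAt g' d 0) (hm : IsLocalMax g 0) : g' 0 = 0 ∧ d ≤ 0 := by
  have h0 : HasDerivAt g (g' 0) 0 := hg.self_of_nhds
  have hz : g' 0 = 0 := hm.hasDerivAt_eq_zero h0
  refine ⟨hz, ?_⟩
  by_contra hlt
  push Not at hlt
  have hE : deriv g =ᶠ[nhds 0] g' := by
    filter_upwards [hg] with t ht using ht.deriv
  have hdd : deriv (deriv g) 0 = d := by rw [hE.deriv_eq]; exact hd.deriv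
  have hmin : IsLocalMin g 0 := isLocalMin_of_deriv_deriv_pos (by rw [hdd]; exact hlt)
    (by rw [h0.deriv, hz]) h0.continuousAt
  have hc : g =ᶠ[nhds 0] fun _ => g 0 := by
    filter_upwards [hmin, hm] with t h1 h2 using le_antisymm h2 h1
  have h1 : deriv g =ᶠ[nhds 0] fun _ => 0 := by
    have := hc.deriv
    simpa using this
  have : deriv (deriv g) 0 = 0 := by rw [h1.deriv_eq]; simp
  linarith

lemma one_dim (V V' : ℝ → ℝ) (D A c ε k : ℝ) (hV : ∀ t, 0 < V t) (hA : 0 < A)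
    (h1 : ∀ t, HasDerivAt V (V' t) t) (h2 : HasDerivAt V' D 0)
    (hm : IsLocalMax (fun t => ε * log (V t) + k * log (A - 2 * c * t - t ^ 2)) 0) :
    ε * (V' 0 / V 0) = 2 * k * c / A ∧
      ε * (D / V 0 - (V' 0 / V 0) ^ 2) ≤ k * (2 / A + 4 * c ^ 2 / A ^ 2) := by
  have hσ : ∀ t : ℝ, HasDerivAt (fun t : ℝ => A - 2 * c * t - t ^ 2) (-2 * c - 2 * t) t := by
    intro t
    have := (((hasDerivAt_id t).const_mul (2 * c)).const_sub A).sub ((hasDerivAt_id t).pow 2)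
    refine this.congr_deriv ?_
    simp
  have hpos : ∀ᶠ t : ℝ in nhds 0, 0 < A - 2 * c * t - t ^ 2 := by
    have hc : ContinuousAt (fun t : ℝ => A - 2 * c * t - t ^ 2) 0 := (hσ 0).continuousAt
    exact hc.eventually (lt_mem_nhds (by simpa using hA))
  have key := second_test (fun t => ε * log (V t) + k * log (A - 2 * c * t - t ^ 2))
    (fun t => ε * (V' t / V t) + k * ((-2 * c - 2 * t) / (A - 2 * c * t - t ^ 2)))
    (ε * ((D * V 0 - V' 0 * V' 0) / V 0 ^ 2) +
      k * (((-2) * A - (-2 * c) * (-2 * c)) / A ^ 2)) ?_ ?_ hm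
  · obtain ⟨k1, k2⟩ := key
    have hV0 := (hV 0).ne'
    simp only [mul_zero, sub_zero, ne_eq, OfNat.ofNat_ne_zero, not_false_eq_true, zero_pow] at k1
    constructor
    · have : 2 * k * c / A = - (k * ((-2 * c) / A)) := by ring
      rw [this]; linarith
    · have e1 : (D * V 0 - V' 0 * V' 0) / V 0 ^ 2 = D / V 0 - (V' 0 / V 0) ^ 2 := by
        field_simp
      have e2 : ((-2) * A - (-2 * c) * (-2 * c)) / A ^ 2 = -(2 / A + 4 * c ^ 2 / A ^ 2) := by
        field_simp; ring
      rw [e1, e2] at k2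
      linarith
  · filter_upwards [hpos] with t ht
    exact (((h1 t).log (hV t).ne').const_mul ε).add (((hσ t).log ht.ne').const_mul k)
  · have hn : HasDerivAt (fun t : ℝ => -2 * c - 2 * t) (-2) 0 := by
      have := ((hasDerivAt_id (0 : ℝ)).const_mul 2).const_sub (-2 * c)
      refine this.congr_deriv ?_
      simp
    have hq := (hn.div (hσ 0) (by simpa using hA.ne')).const_mul k
    have hp := (h2.div (h1 0) (hV 0).ne').const_mul ε
    refine (hp.add hq).congr_deriv ?_
    simp

lemma exists_touch {n : ℕ} (v : EuclideanSpace ℝ (Fin n) → ℝ) (hv : ContDiff ℝ (⊤ : ℕ∞) v)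
    (hpos : ∀ x, 0 < v x) (x₀ : EuclideanSpace ℝ (Fin n)) (R ε k : ℝ) (hR : 0 < R)
    (hk : 0 < k) :
    ∃ y, ∃ A : ℝ, A = R ^ 2 - ‖y - x₀‖ ^ 2 ∧ 0 < A ∧
      ε * log (v x₀) + k * log (R ^ 2) ≤ ε * log (v y) + k * log A ∧
      ∀ i, ∃ w : ℝ, ε * w = 2 * k * (y - x₀) i / A ∧
        ε * (fderiv ℝ (fun y => fderiv ℝ v y (EuclideanSpace.single i 1)) y
          (EuclideanSpace.single i 1) / v y - w ^ 2) ≤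
          k * (2 / A + 4 * ((y - x₀) i) ^ 2 / A ^ 2) := by
  have hvc : Continuous v := hv.continuous
  have hlc : Continuous fun x => log (v x) := hvc.log fun x => (hpos x).ne'
  have hcont : Continuous fun x => exp (ε * log (v x)) * (R ^ 2 - ‖x - x₀‖ ^ 2) ^ k :=
    (continuous_exp.comp (continuous_const.mul hlc)).mul
      ((by fun_prop : Continuous fun x => R ^ 2 - ‖x - x₀‖ ^ 2).rpow_const
        fun x => Or.inr hk.le)
  obtain ⟨y, hyB, hy⟩ := (isCompact_closedBall x₀ R).exists_isMaxOn
    ⟨x₀, Metric.mem_closedBall_self hR.le⟩ hcont.continuousOn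
  have hmax : ∀ x, ‖x - x₀‖ ≤ R → exp (ε * log (v x)) * (R ^ 2 - ‖x - x₀‖ ^ 2) ^ k ≤
      exp (ε * log (v y)) * (R ^ 2 - ‖y - x₀‖ ^ 2) ^ k := fun x hx =>
    hy (by simpa [dist_eq_norm] using hx)
  have hyn : ‖y - x₀‖ ≤ R := by simpa [dist_eq_norm] using hyB
  have hA0 : 0 ≤ R ^ 2 - ‖y - x₀‖ ^ 2 := by
    have := norm_nonneg (y - x₀)
    nlinarith
  have hA : 0 < R ^ 2 - ‖y - x₀‖ ^ 2 := by
    rcases hA0.lt_or_eq with h | h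
    · exact h
    · exfalso
      have h3 := hmax x₀ (by simpa using hR.le)
      rw [← h, zero_rpow hk.ne'] at h3
      have : 0 < exp (ε * log (v x₀)) * (R ^ 2 - ‖x₀ - x₀‖ ^ 2) ^ k := by
        apply mul_pos (exp_pos _)
        apply rpow_pos_of_pos
        simp; positivity
      linarith
  have hlog : ∀ x, 0 < R ^ 2 - ‖x - x₀‖ ^ 2 →
      ε * log (v x) + k * log (R ^ 2 - ‖x - x₀‖ ^ 2) ≤
      ε * log (v y) + k * log (R ^ 2 - ‖y - x₀‖ ^ 2) := by
    intro x hx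
    have h3 := hmax x (by
      have := norm_nonneg (x - x₀)
      nlinarith)
    have h4 := log_le_log (mul_pos (exp_pos _) (rpow_pos_of_pos hx k)) h3
    rwa [log_mul (exp_pos _).ne' (rpow_pos_of_pos hx k).ne',
      log_mul (exp_pos _).ne' (rpow_pos_of_pos hA k).ne', log_exp, log_exp,
      log_rpow hx, log_rpow hA] at h4
  refine ⟨y, _, rfl, hA, ?_, ?_⟩
  · have := hlog x₀ (by simp; positivity)
    simpa using this
  · intro i
    set e : EuclideanSpace ℝ (Fin n) := EuclideanSpace.single i 1 with he
    have hline : ∀ t : ℝ, HasDerivAt (fun t : ℝ => y + t • e) e t := by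
      intro t
      have := ((hasDerivAt_id t).smul_const e).const_add y
      simpa using this
    have hnorm : ∀ t : ℝ, R ^ 2 - ‖y + t • e - x₀‖ ^ 2 =
        R ^ 2 - ‖y - x₀‖ ^ 2 - 2 * (y - x₀) i * t - t ^ 2 := by
      intro t
      have h5 : y + t • e - x₀ = (y - x₀) + t • e := by abel
      rw [h5, norm_add_sq_real, inner_smul_right, norm_smul]
      have h6 : inner ℝ (y - x₀) e = (y - x₀) i := by
        rw [he, EuclideanSpace.inner_single_right]; simp
      have h7 : ‖e‖ = 1 := by rw [he]; simp
      rw [h6, h7, mul_one, Real.norm_eq_abs, sq_abs]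
      ring
    have hdv : Differentiable ℝ v := hv.differentiable (by simp)
    have hdv2 : Differentiable ℝ (fun y => fderiv ℝ v y e) := by
      have : ContDiff ℝ 1 (fderiv ℝ v) := (contDiff_infty.1 hv 2).fderiv_right (by norm_num)
      exact (this.differentiable (by simp)).clm_apply (differentiable_const e)
    have h := one_dim (fun t => v (y + t • e)) (fun t => fderiv ℝ v (y + t • e) e)
      (fderiv ℝ (fun y => fderiv ℝ v y e) y e) (R ^ 2 - ‖y - x₀‖ ^ 2) ((y - x₀) i) ε k
      (fun t => hpos _) hA
      (fun t => (hdv _).hasFDerivAt.comp_hasDerivAt t (hline t))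
      (by
        have h8 := (hdv2 (y + (0 : ℝ) • e)).hasFDerivAt.comp_hasDerivAt (0 : ℝ) (hline 0)
        have h9 : y + (0 : ℝ) • e = y := by simp
        rw [h9] at h8
        exact h8)
      (by
        have hc : ContinuousAt (fun t : ℝ => R ^ 2 - ‖y + t • e - x₀‖ ^ 2) 0 := by fun_prop
        have hev : ∀ᶠ t : ℝ in nhds 0, 0 < R ^ 2 - ‖y + t • e - x₀‖ ^ 2 :=
          hc.eventually (lt_mem_nhds (by simpa using hA))
        filter_upwards [hev] with t ht
        have := hlog _ ht
        rw [hnorm t] at this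
        simpa using this)
    refine ⟨_, h.1, ?_⟩
    simpa using h.2

/-- Summed form. -/
lemma upper_touch {n : ℕ} (v : EuclideanSpace ℝ (Fin n) → ℝ) (hv : ContDiff ℝ (⊤ : ℕ∞) v)
    (hpos : ∀ x, 0 < v x) (x₀ : EuclideanSpace ℝ (Fin n)) (R k : ℝ) (hR : 0 < R)
    (hk : 0 < k) :
    ∃ y, ∃ A : ℝ, 0 < A ∧ A ≤ R ^ 2 ∧
      log (v x₀) + k * log (R ^ 2) ≤ log (v y) + k * log A ∧
      lap v y / v y ≤ (4 * k * (k + 1) + 2 * n * k) * R ^ 2 / A ^ 2 := by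
  obtain ⟨y, A, hAe, hA, hle, hi⟩ := exists_touch v hv hpos x₀ R 1 k hR hk
  have hAR : A ≤ R ^ 2 := by rw [hAe]; nlinarith [sq_nonneg ‖y - x₀‖]
  refine ⟨y, A, hA, hAR, by simpa using hle, ?_⟩
  have hsum : ‖y - x₀‖ ^ 2 = ∑ i, ((y - x₀) i) ^ 2 := EuclideanSpace.real_norm_sq_eq _
  have h1 : lap v y / v y ≤ ∑ i : Fin n, (4 * k * (k + 1) / A ^ 2 * ((y - x₀) i) ^ 2 + 2 * k / A) := by
    rw [lap, Finset.sum_div]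
    refine Finset.sum_le_sum fun i _ => ?_
    obtain ⟨w, hw, h⟩ := hi i
    rw [one_mul] at hw h
    rw [hw] at h
    have e : k * (2 / A + 4 * ((y - x₀) i) ^ 2 / A ^ 2) + (2 * k * (y - x₀) i / A) ^ 2 =
      4 * k * (k + 1) / A ^ 2 * ((y - x₀) i) ^ 2 + 2 * k / A := by
      field_simp; ring
    linarith
  rw [Finset.sum_add_distrib, ← Finset.mul_sum, ← hsum] at h1
  simp only [Finset.sum_const, Finset.card_univ, Fintype.card_fin, nsmul_eq_mul] at h1
  refine h1.trans ?_
  have e : 4 * k * (k + 1) / A ^ 2 * ‖y - x₀‖ ^ 2 + n * (2 * k / A) =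
      (4 * k * (k + 1) * ‖y - x₀‖ ^ 2 + 2 * n * k * A) / A ^ 2 := by
    field_simp
  rw [e]
  apply div_le_div_of_nonneg_right _ (by positivity)
  have h2 : ‖y - x₀‖ ^ 2 ≤ R ^ 2 := by linarith
  have h3 : 4 * k * (k + 1) * ‖y - x₀‖ ^ 2 ≤ 4 * k * (k + 1) * R ^ 2 := by gcongr
  have h4 : 2 * n * k * A ≤ 2 * n * k * R ^ 2 := by gcongr
  linarith

lemma lower_touch {n : ℕ} (v : EuclideanSpace ℝ (Fin n) → ℝ) (hv : ContDiff ℝ (⊤ : ℕ∞) v)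
    (hpos : ∀ x, 0 < v x) (x₀ : EuclideanSpace ℝ (Fin n)) (R : ℝ) (hR : 0 < R) :
    ∃ y, v y ≤ v x₀ ∧ -(2 * n * (n + 2)) / R ^ 2 ≤ lap v y / v y := by
  obtain ⟨y, A, hAe, hA, hle, hi⟩ := exists_touch v hv hpos x₀ R (-1) 2 hR two_pos
  have hAR : A ≤ R ^ 2 := by rw [hAe]; nlinarith [sq_nonneg ‖y - x₀‖]
  refine ⟨y, ?_, ?_⟩
  · have := log_le_log hA hAR
    exact (log_le_log_iff (hpos _) (hpos _)).1 (by linarith)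
  have hsum : ‖y - x₀‖ ^ 2 = ∑ i, ((y - x₀) i) ^ 2 := EuclideanSpace.real_norm_sq_eq _
  have h1 : ∑ i : Fin n, (8 / A ^ 2 * ((y - x₀) i) ^ 2 - 4 / A) ≤ lap v y / v y := by
    rw [lap, Finset.sum_div]
    refine Finset.sum_le_sum fun i _ => ?_
    obtain ⟨w, hw, h⟩ := hi i
    have hw' : w = -(2 * 2 * (y - x₀) i / A) := by linarith
    rw [hw'] at h
    have e : (-(2 * 2 * (y - x₀) i / A)) ^ 2 - 2 * (2 / A + 4 * ((y - x₀) i) ^ 2 / A ^ 2) =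
      8 / A ^ 2 * ((y - x₀) i) ^ 2 - 4 / A := by
      field_simp; ring
    linarith
  rw [Finset.sum_sub_distrib, ← Finset.mul_sum, ← hsum] at h1
  simp only [Finset.sum_const, Finset.card_univ, Fintype.card_fin, nsmul_eq_mul] at h1
  refine le_trans ?_ h1
  have hr : ‖y - x₀‖ ^ 2 = R ^ 2 - A := by linarith
  have e : 8 / A ^ 2 * ‖y - x₀‖ ^ 2 - n * (4 / A) = (8 * (R ^ 2 - A) - 4 * n * A) / A ^ 2 := by
    rw [hr]; field_simp
  rw [e, div_le_div_iff₀ (by positivity) (by positivity)]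
  generalize R ^ 2 = S at *
  have hn : (0 : ℝ) ≤ n := Nat.cast_nonneg n
  by_cases hc : (n + 2) * A ≤ 2 * S
  · have : 0 ≤ (8 * (S - A) - 4 * n * A) * S :=
      mul_nonneg (by linarith) (by linarith)
    have : 0 ≤ (2 * n * (n + 2)) * A ^ 2 := by positivity
    linarith
  · push Not at hc
    have h5 : 2 * (n * A) * S ≤ (n * A) * ((n + 2) * A) := by nlinarith [mul_nonneg hn hA.le]
    have h6 : 0 ≤ (S - A) * S := mul_nonneg (by linarith) (by linarith)
    nlinarith

theorem stmt_3 (n : ℕ) (hn : 3 ≤ n) (μ a b p q : ℝ)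
    (hμ : 0 ≤ μ) (ha : a < 0) (hb : 0 ≤ b) (hq : 1 ≤ q) (hp : 0 < p)
    (hbμ : b + μ ≠ 0)
    (hcase : a * (2 / ((n : ℝ) - 1) - p) ≥ 0 ∨ (0 < p ∧ p < 4 / ((n : ℝ) - 1)))
    (v : EuclideanSpace ℝ (Fin n) → ℝ) (hv : ContDiff ℝ (⊤ : ℕ∞) v)
    (hpos : ∀ x, 0 < v x)
    (heq : ∀ x, lap v x + μ * v x + a * v x ^ (p + 1) + b * v x ^ (1 - q) = 0) :
    ∀ x y, v x = v y := by
  set G : ℝ → ℝ := fun s => -a * s ^ p - μ - b * s ^ (-q) with hG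
  have hGv : ∀ x, lap v x / v x = G (v x) := by
    intro x
    have h := heq x
    have hx := hpos x
    rw [rpow_add hx, rpow_one, sub_eq_add_neg, rpow_add hx, rpow_one] at h
    rw [div_eq_iff hx.ne', hG]
    linear_combination h
  have hmono : ∀ s t, 0 < s → s < t → G s < G t := by
    intro s t hs hst
    have h1 : s ^ p < t ^ p := rpow_lt_rpow hs.le hst hp
    have h2 : t ^ (-q) ≤ s ^ (-q) := rpow_le_rpow_of_nonpos hs hst.le (by linarith)
    have h3 := mul_le_mul_of_nonneg_left h2 hb
    have h4 := mul_lt_mul_of_pos_left h1 (neg_pos.2 ha)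
    simp only [hG]
    linarith
  have hmono' : ∀ s t, 0 < s → s ≤ t → G s ≤ G t := by
    intro s t hs hst
    rcases hst.lt_or_eq with h | h
    · exact (hmono s t hs h).le
    · rw [h]
  have hlow : ∀ x, 0 ≤ G (v x) := by
    intro x
    by_contra hneg
    push Not at hneg
    set C : ℝ := 2 * n * (n + 2) + 1 with hC
    have hCpos : 0 < C := by positivity
    have hR : 0 < √(C / -G (v x)) := sqrt_pos.2 (div_pos hCpos (by linarith))
    obtain ⟨y, hy, h⟩ := lower_touch v hv hpos x _ hR
    rw [hGv y, sq_sqrt (div_pos hCpos (by linarith)).le] at h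
    have h2 := hmono' _ _ (hpos y) hy
    have h3 := h.trans h2
    rw [div_le_iff₀ (div_pos hCpos (by linarith))] at h3
    have h4 : G (v x) * (C / -G (v x)) = -C := by
      have : G (v x) ≠ 0 := hneg.ne
      field_simp
    rw [h4] at h3
    linarith
  have hup : ∀ x, G (v x) ≤ 0 := by
    intro x
    by_contra hneg
    push Not at hneg
    set k : ℝ := 2 / p with hk
    have hkp : 0 < k := by positivity
    set C : ℝ := 4 * k * (k + 1) + 2 * n * k with hC
    have hCpos : 0 < C := by positivity
    have hR : 0 < √((C + 1) / G (v x)) := sqrt_pos.2 (by positivity)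
    obtain ⟨y, A, hA, hAR, hle, h⟩ := upper_touch v hv hpos x _ k hR hkp
    rw [← hC] at h
    rw [hGv y, sq_sqrt (by positivity)] at h
    rw [sq_sqrt (by positivity)] at hAR hle
    set S : ℝ := (C + 1) / G (v x) with hS
    have hSpos : 0 < S := by positivity
    set m : ℝ := (S / A) ^ k with hm
    have hm1 : 1 ≤ m := one_le_rpow ((one_le_div hA).2 hAR) hkp.le
    have hmp : m ^ p = (S / A) ^ 2 := by
      rw [hm, ← rpow_mul (by positivity)]
      have : k * p = (2 : ℕ) := by rw [hk]; field_simp; norm_num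
      rw [this, rpow_natCast]
    have hvy : v x * m ≤ v y := by
      have hmpos : 0 < m := by linarith
      rw [← log_le_log_iff (mul_pos (hpos x) hmpos) (hpos y),
        log_mul (hpos x).ne' hmpos.ne', hm, log_rpow (by positivity),
        log_div hSpos.ne' hA.ne']
      linarith
    have hGm : m ^ p * G (v x) ≤ G (v x * m) := by
      have h1 : 1 ≤ m ^ p := one_le_rpow hm1 hp.le
      have h2 : m ^ (-q) ≤ 1 := rpow_le_one_of_one_le_of_nonpos hm1 (by linarith)
      simp only [hG]
      rw [mul_rpow (hpos x).le (by linarith), mul_rpow (hpos x).le (by linarith)]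
      have h3 : 0 ≤ b * v x ^ (-q) := mul_nonneg hb (rpow_nonneg (hpos x).le _)
      have h4 : 0 ≤ b * v x ^ (-q) * (m ^ p - m ^ (-q)) := mul_nonneg h3 (by linarith)
      have h5 : 0 ≤ μ * (m ^ p - 1) := mul_nonneg hμ (by linarith)
      linarith
    have h6 := (hGm.trans (hmono' _ _ (mul_pos (hpos x) (by linarith)) hvy)).trans h
    rw [hmp, div_pow, div_mul_eq_mul_div, div_le_div_iff_of_pos_right (by positivity)] at h6
    have h7 : S * G (v x) = C + 1 := by rw [hS]; field_simp
    have h8 : S ^ 2 * G (v x) = (C + 1) * S := by rw [← h7]; ring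
    rw [h8] at h6
    linarith
  intro x y
  have hx : G (v x) = 0 := le_antisymm (hup x) (hlow x)
  have hy : G (v y) = 0 := le_antisymm (hup y) (hlow y)
  rcases lt_trichotomy (v x) (v y) with h | h | h
  · have := hmono _ _ (hpos x) h
    linarith
  · exact h
  · have := hmono _ _ (hpos y) h
    linarith
end

section
/- Let n ≥ 3 be an integer and let μ ≥ 0, a ≤ 0, b ≥ 0 be real constants. Then every smooth function v : ℝⁿ → ℝ with v > 0 everywhere satisfying the Einstein-scalar field Lichnerowicz-type equation Δv + μ·v + a·v^{(n+2)/(n−2)} + b·v^{−(3n−2)/(n−2)} = 0 on all of ℝⁿ is a constant function. (This is the Euclidean case of the Liouville assertion in Theorem 3.) -/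
open Real

lemma second_deriv_nonpos {f f' : ℝ → ℝ} {c : ℝ} (h1 : ∀ᶠ t in nhds 0, HasDerivAt f (f' t) t)
    (h2 : HasDerivAt f' c 0) (hm : IsLocalMax f 0) : c ≤ 0 := by
  by_contra hc
  push Not at hc
  have hd : deriv f =ᶠ[nhds 0] f' := h1.mono fun t ht => ht.deriv
  have hdd : deriv (deriv f) 0 = c := by rw [hd.deriv_eq, h2.deriv]
  have hmin : IsLocalMin f 0 := isLocalMin_of_deriv_deriv_pos (by rw [hdd]; exact hc)
    hm.deriv_eq_zero h1.self_of_nhds.continuousAt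
  have hcst : f =ᶠ[nhds 0] fun _ => f 0 := by
    filter_upwards [hm, hmin] with t ht ht' using le_antisymm ht ht'
  have h3 : deriv (deriv f) 0 = 0 := by
    have := hcst.deriv.deriv_eq
    rw [this]; simp
  linarith

/-- the quadratic cutoff -/
noncomputable def cut {n : ℕ} (y : EuclideanSpace ℝ (Fin n)) (R : ℝ)
    (x : EuclideanSpace ℝ (Fin n)) : ℝ := R ^ 2 - ‖x - y‖ ^ 2

lemma cut_line {n : ℕ} (y x : EuclideanSpace ℝ (Fin n)) (R : ℝ) (i : Fin n) (t : ℝ) :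
    cut y R (x + t • EuclideanSpace.single i (1 : ℝ)) = cut y R x - 2 * t * (x i - y i) - t ^ 2 := by
  unfold cut
  have h : x + t • EuclideanSpace.single i (1 : ℝ) - y
      = (x - y) + t • EuclideanSpace.single i (1 : ℝ) := by abel
  rw [h, norm_add_sq_real, inner_smul_right, norm_smul, EuclideanSpace.inner_single_right]
  simp
  ring

lemma cut_continuous {n : ℕ} (y : EuclideanSpace ℝ (Fin n)) (R : ℝ) : Continuous (cut y R) := by
  unfold cut; fun_prop

lemma line_deriv1 {n : ℕ} {v : EuclideanSpace ℝ (Fin n) → ℝ} (hv : Differentiable ℝ v)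
    (x e : EuclideanSpace ℝ (Fin n)) (t : ℝ) :
    HasDerivAt (fun t : ℝ => v (x + t • e)) (fderiv ℝ v (x + t • e) e) t := by
  have h1 : HasDerivAt (fun t : ℝ => x + t • e) e t := by
    simpa using ((hasDerivAt_id t).smul_const e).const_add x
  exact (hv (x + t • e)).hasFDerivAt.comp_hasDerivAt t h1

lemma diff_partial {n : ℕ} {v : EuclideanSpace ℝ (Fin n) → ℝ} (hv : ContDiff ℝ (⊤ : ℕ∞) v)
    (e : EuclideanSpace ℝ (Fin n)) : ContDiff ℝ (⊤ : ℕ∞) (fun y => fderiv ℝ v y e) := by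
  have : ContDiff ℝ (⊤ : ℕ∞) (fderiv ℝ v) := hv.fderiv_right (by simp)
  exact this.clm_apply contDiff_const

lemma max_coord {n : ℕ} {v : EuclideanSpace ℝ (Fin n) → ℝ} (hv : ContDiff ℝ (⊤ : ℕ∞) v)
    (y x : EuclideanSpace ℝ (Fin n)) (R m c d : ℝ) (hs : 0 < cut y R x)
    (hm : IsLocalMax (fun z => c * v z + d * cut y R z ^ m) x) (i : Fin n) :
    c * fderiv ℝ (fun y => fderiv ℝ v y (EuclideanSpace.single i 1)) x (EuclideanSpace.single i 1)
     + d * (m * (m - 1) * cut y R x ^ (m - 2) * 4 * (x i - y i) ^ 2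
        - 2 * m * cut y R x ^ (m - 1)) ≤ 0 := by
  set e := EuclideanSpace.single i (1 : ℝ) with he
  set S : ℝ → ℝ := fun t => cut y R x - 2 * t * (x i - y i) - t ^ 2 with hS
  have hSd : ∀ t, HasDerivAt S (- 2 * (x i - y i) - 2 * t) t := by
    intro t
    have h1 := ((hasDerivAt_const t (cut y R x)).sub
      (((hasDerivAt_id t).const_mul 2).mul_const (x i - y i))).sub ((hasDerivAt_id t).pow 2)
    refine h1.congr_deriv ?_
    simp
  have hS0 : S 0 = cut y R x := by simp [hS]
  have hSpos : ∀ᶠ t in nhds (0 : ℝ), 0 < S t := by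
    have : ContinuousAt S 0 := (hSd 0).continuousAt
    exact this.eventually (lt_mem_nhds (by rw [hS0]; exact hs))
  have hvd : Differentiable ℝ v := hv.differentiable (by simp)
  have hpd : Differentiable ℝ (fun y => fderiv ℝ v y e) := (diff_partial hv e).differentiable (by simp)
  refine second_deriv_nonpos (f := fun t => c * v (x + t • e) + d * S t ^ m)
    (f' := fun t => c * fderiv ℝ v (x + t • e) e
      + d * ((- 2 * (x i - y i) - 2 * t) * m * S t ^ (m - 1))) ?_ ?_ ?_
  · filter_upwards [hSpos] with t ht
    exact ((line_deriv1 hvd x e t).const_mul c).add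
      (((hSd t).rpow_const (Or.inl ht.ne')).const_mul d)
  · have h1 := line_deriv1 hpd x e 0
    have h2 := (hSd 0).rpow_const (p := m - 1) (Or.inl hSpos.self_of_nhds.ne')
    have h3 : HasDerivAt (fun t : ℝ => (- 2 * (x i - y i) - 2 * t) * m) (-2 * m) 0 := by
      have := (((hasDerivAt_id (0:ℝ)).const_mul 2).const_sub (- 2 * (x i - y i))).mul_const m
      refine this.congr_deriv ?_
      simp
    refine ((h1.const_mul c).add ((h3.mul h2).const_mul d)).congr_deriv ?_
    rw [hS0]
    simp only [zero_smul, add_zero]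
    rw [show m - 1 - 1 = m - 2 by ring]
    ring
  · have hc : ContinuousAt (fun t : ℝ => x + t • e) 0 := by fun_prop
    have ht : Filter.Tendsto (fun t : ℝ => x + t • e) (nhds 0) (nhds x) := by
      simpa [ContinuousAt] using hc
    filter_upwards [ht.eventually hm] with t h
    simpa only [he, cut_line, hS, zero_smul, add_zero, mul_zero, zero_mul, sub_zero, ne_eq,
      OfNat.ofNat_ne_zero, not_false_eq_true, zero_pow] using h

lemma max_lap {n : ℕ} {v : EuclideanSpace ℝ (Fin n) → ℝ} (hv : ContDiff ℝ (⊤ : ℕ∞) v)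
    (y x : EuclideanSpace ℝ (Fin n)) (R m c d : ℝ) (hs : 0 < cut y R x)
    (hm : IsLocalMax (fun z => c * v z + d * cut y R z ^ m) x) :
    c * lap v x + d * (m * (m - 1) * cut y R x ^ (m - 2) * 4 * (R ^ 2 - cut y R x)
        - 2 * n * m * cut y R x ^ (m - 1)) ≤ 0 := by
  have h := Finset.sum_nonpos fun i (_ : i ∈ Finset.univ) => max_coord hv y x R m c d hs hm i
  have hr : R ^ 2 - cut y R x = ∑ i, (x i - y i) ^ 2 := by
    unfold cut
    rw [EuclideanSpace.norm_sq_eq]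
    simp
  refine le_trans (le_of_eq ?_) h
  rw [hr, Finset.sum_add_distrib, ← Finset.mul_sum, ← Finset.mul_sum, Finset.sum_sub_distrib,
    ← Finset.mul_sum]
  simp only [lap, Finset.sum_const, Finset.card_univ, Fintype.card_fin, nsmul_eq_mul]
  ring

lemma exists_max {n : ℕ} {u : EuclideanSpace ℝ (Fin n) → ℝ} (hu : Continuous u)
    (hpos : ∀ x, 0 < u x) (y : EuclideanSpace ℝ (Fin n)) {R p : ℝ} (hR : 0 < R) (hp : 0 < p) :
    ∃ x, 0 < cut y R x ∧ ∀ z, 0 < cut y R z → u z * cut y R z ^ p ≤ u x * cut y R x ^ p := by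
  have hcont : ContinuousOn (fun z => u z * cut y R z ^ p) (Metric.closedBall y R) := by
    refine (hu.mul ?_).continuousOn
    exact (cut_continuous y R).rpow_const fun _ => Or.inr hp.le
  obtain ⟨x, hx, hmax⟩ := (isCompact_closedBall y R).exists_isMaxOn
    ⟨y, Metric.mem_closedBall_self hR.le⟩ hcont
  have hin : ∀ z, 0 < cut y R z → z ∈ Metric.closedBall y R := by
    intro z hz
    rw [mem_closedBall_iff_norm]
    unfold cut at hz
    exact le_of_lt (lt_of_pow_lt_pow_left₀ 2 hR.le (by linarith))
  have hy : cut y R y = R ^ 2 := by simp [cut]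
  have hcx : 0 ≤ cut y R x := by
    rw [mem_closedBall_iff_norm] at hx
    unfold cut
    have := pow_le_pow_left₀ (norm_nonneg _) hx 2
    linarith
  refine ⟨x, ?_, fun z hz => hmax (hin z hz)⟩
  refine lt_of_le_of_ne hcx fun h0 => ?_
  have h1 := hmax (hin y (by rw [hy]; positivity))
  simp only [Set.mem_ofPred_eq, hy, ← h0, Real.zero_rpow hp.ne', mul_zero] at h1
  have : 0 < u y * (R ^ 2) ^ p := mul_pos (hpos y) (by positivity)
  linarith

/-- nonlinearity divided by v -/
noncomputable def gfun (μ a b α β V : ℝ) : ℝ := -μ - a * V ^ α - b * V ^ (-β)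

lemma gfun_mono {μ a b α β V W : ℝ} (ha : a ≤ 0) (hb : 0 ≤ b) (hα : 0 < α) (hβ : 0 < β)
    (hV : 0 < V) (hVW : V ≤ W) : gfun μ a b α β V ≤ gfun μ a b α β W := by
  unfold gfun
  have h1 : V ^ α ≤ W ^ α := Real.rpow_le_rpow hV.le hVW hα.le
  have h2 : W ^ (-β) ≤ V ^ (-β) := Real.rpow_le_rpow_of_nonpos hV hVW (by linarith)
  nlinarith [mul_le_mul_of_nonneg_left h2 hb, mul_le_mul_of_nonpos_left h1 ha]

lemma lower {n : ℕ} {v : EuclideanSpace ℝ (Fin n) → ℝ} (hv : ContDiff ℝ (⊤ : ℕ∞) v)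
    (hpos : ∀ x, 0 < v x) {g : ℝ → ℝ} (hg : ∀ V W, 0 < V → V ≤ W → g V ≤ g W)
    (heq : ∀ x, lap v x = v x * g (v x)) (y : EuclideanSpace ℝ (Fin n)) {R : ℝ} (hR : 0 < R) :
    -(((n : ℝ) + 2) ^ 2 / 2) / R ^ 2 ≤ g (v y) := by
  obtain ⟨x, hx, hmax⟩ := exists_max (u := fun z => (v z)⁻¹) (hv.continuous.inv₀ fun z => (hpos z).ne')
    (fun z => inv_pos.2 (hpos z)) y hR (p := 2) (by norm_num)
  set s := cut y R x with hs
  have hy : cut y R y = R ^ 2 := by simp [cut]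
  have hsR : s ≤ R ^ 2 := by
    rw [hs]; unfold cut; nlinarith [norm_nonneg (x - y)]
  have hvx := hpos x
  have hvy := hpos y
  have hle : v x ≤ v y := by
    have h := hmax y (by rw [hy]; positivity)
    rw [hy, Real.rpow_two, Real.rpow_two] at h
    have h2 : (v x)⁻¹ * s ^ 2 ≤ (v x)⁻¹ * (R ^ 2) ^ 2 := by gcongr
    have h3 := le_of_mul_le_mul_right (h.trans h2) (by positivity)
    exact (inv_le_inv₀ hvy hvx).1 h3
  have hloc : IsLocalMax (fun z => (-1) * v z + (v x / s ^ 2) * cut y R z ^ (2 : ℝ)) x := by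
    have : ∀ᶠ z in nhds x, 0 < cut y R z :=
      (cut_continuous y R).continuousAt.eventually (lt_mem_nhds hx)
    filter_upwards [this] with z hz
    have h := hmax z hz
    simp only [Real.rpow_two] at h ⊢
    rw [← hs]
    have e1 : v x / s ^ 2 * s ^ 2 = v x := by field_simp
    rw [e1]
    have hvz := hpos z
    have h4 : v x / s ^ 2 * cut y R z ^ 2 ≤ v z := by
      calc v x / s ^ 2 * cut y R z ^ 2 = (v x / s ^ 2 * v z) * ((v z)⁻¹ * cut y R z ^ 2) := by
            field_simp
        _ ≤ (v x / s ^ 2 * v z) * ((v x)⁻¹ * s ^ 2) := by gcongr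
        _ = v z := by field_simp
    linarith
  have h := max_lap hv y x R 2 (-1) (v x / s ^ 2) hx hloc
  rw [← hs, heq] at h
  norm_num at h
  have h5 : (v x / s ^ 2) * (2 * 4 * (R ^ 2 - s) - 2 * n * 2 * s) ≤ v x * g (v x) := by linarith
  have h6 : (2 * 4 * (R ^ 2 - s) - 2 * n * 2 * s) / s ^ 2 ≤ g (v x) := by
    refine le_of_mul_le_mul_left (le_trans (le_of_eq ?_) h5) hvx
    ring
  refine le_trans ?_ (h6.trans (hg _ _ hvx hle))
  rw [div_le_div_iff₀ (by positivity) (by positivity)]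
  nlinarith [sq_nonneg (R ^ 2 - (n + 2) * s / 4)]

lemma upper {n : ℕ} {v : EuclideanSpace ℝ (Fin n) → ℝ} (hv : ContDiff ℝ (⊤ : ℕ∞) v)
    (hpos : ∀ x, 0 < v x) {μ a b α β k : ℝ} (hμ : 0 ≤ μ) (ha : a ≤ 0) (hb : 0 ≤ b)
    (hα : 0 < α) (hβ : 0 < β) (hk : 0 < k) (hkα : k * α = 2)
    (heq : ∀ x, lap v x = v x * gfun μ a b α β (v x)) (y : EuclideanSpace ℝ (Fin n))
    {R : ℝ} (hR : 0 < R) :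
    gfun μ a b α β (v y) ≤ (4 * k * (k + 1) + 2 * n * k) / R ^ 2 := by
  obtain ⟨x, hx, hmax⟩ := exists_max hv.continuous hpos y hR hk
  set s := cut y R x with hs
  have hy : cut y R y = R ^ 2 := by simp [cut]
  have hsR : s ≤ R ^ 2 := by
    rw [hs]; unfold cut; nlinarith [norm_nonneg (x - y)]
  have hvx := hpos x
  have hvy := hpos y
  have hsk : 0 < s ^ k := Real.rpow_pos_of_pos hx k
  set lam := R ^ 2 / s with hlam
  have hlam1 : 1 ≤ lam := by rw [hlam, one_le_div hx]; exact hsR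
  have hlam0 : 0 < lam := by linarith
  have hle : v y * lam ^ k ≤ v x := by
    have h := hmax y (by rw [hy]; positivity)
    rw [hy] at h
    rw [hlam, Real.div_rpow (by positivity) hx.le, ← mul_div_assoc, div_le_iff₀ hsk]
    exact h
  have hle1 : v y ≤ v x := by
    refine le_trans ?_ hle
    have := Real.one_le_rpow hlam1 hk.le
    nlinarith
  have hloc : IsLocalMax (fun z => 1 * v z + (-(v x * s ^ k)) * cut y R z ^ (-k)) x := by
    have : ∀ᶠ z in nhds x, 0 < cut y R z :=
      (cut_continuous y R).continuousAt.eventually (lt_mem_nhds hx)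
    filter_upwards [this] with z hz
    have h := hmax z hz
    rw [← hs]
    have hzk : 0 < cut y R z ^ k := Real.rpow_pos_of_pos hz k
    rw [Real.rpow_neg hz.le, Real.rpow_neg hx.le]
    have e1 : v x * s ^ k * (s ^ k)⁻¹ = v x := by field_simp
    have e2 : v z ≤ v x * s ^ k * (cut y R z ^ k)⁻¹ := by
      rw [← div_eq_mul_inv, le_div_iff₀ hzk]; exact h
    linarith
  have h := max_lap hv y x R (-k) 1 (-(v x * s ^ k)) hx hloc
  rw [← hs, heq] at h
  have p1 : s ^ (-k - 2) = (s ^ k)⁻¹ / s ^ 2 := by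
    rw [Real.rpow_sub hx, Real.rpow_neg hx.le, Real.rpow_two]
  have p2 : s ^ (-k - 1) = (s ^ k)⁻¹ / s := by
    rw [Real.rpow_sub hx, Real.rpow_neg hx.le, Real.rpow_one]
  rw [p1, p2] at h
  have h5 : gfun μ a b α β (v x) ≤ 4 * k * (k + 1) * (R ^ 2 - s) / s ^ 2 + 2 * n * k / s := by
    refine le_of_mul_le_mul_left ?_ hvx
    have e : v x * s ^ k * ((-k) * (-k - 1) * ((s ^ k)⁻¹ / s ^ 2) * 4 * (R ^ 2 - s)
        - 2 * n * (-k) * ((s ^ k)⁻¹ / s))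
        = v x * (4 * k * (k + 1) * (R ^ 2 - s) / s ^ 2 + 2 * n * k / s) := by
      field_simp
      ring
    linarith
  have h6 : lam ^ 2 * gfun μ a b α β (v y) ≤ gfun μ a b α β (v x) := by
    unfold gfun
    have q1 : v y ^ α * lam ^ 2 ≤ v x ^ α := by
      have := Real.rpow_le_rpow (by positivity) hle hα.le
      rwa [Real.mul_rpow hvy.le (by positivity), ← Real.rpow_mul hlam0.le, hkα, Real.rpow_two]
        at this
    have q2 : v x ^ (-β) ≤ v y ^ (-β) := Real.rpow_le_rpow_of_nonpos hvy hle1 (by linarith)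
    have q3 : 1 ≤ lam ^ 2 := one_le_pow₀ hlam1
    have q4 : 0 < v y ^ (-β) := Real.rpow_pos_of_pos hvy _
    have r1 : μ ≤ lam ^ 2 * μ := by nlinarith
    have r2 : b * v x ^ (-β) ≤ lam ^ 2 * (b * v y ^ (-β)) := by
      have := mul_le_mul_of_nonneg_left q2 hb
      have := mul_nonneg hb q4.le
      nlinarith
    have r3 := mul_le_mul_of_nonpos_left q1 ha
    nlinarith
  have h7 : 4 * k * (k + 1) * (R ^ 2 - s) / s ^ 2 + 2 * n * k / s
      ≤ lam ^ 2 * ((4 * k * (k + 1) + 2 * n * k) / R ^ 2) := by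
    have e : lam ^ 2 * ((4 * k * (k + 1) + 2 * n * k) / R ^ 2)
       = 4 * k * (k + 1) * R ^ 2 / s ^ 2 + 2 * n * k * R ^ 2 / s ^ 2 := by
      rw [hlam]; field_simp
    rw [e]
    have t1 : 4 * k * (k + 1) * (R ^ 2 - s) / s ^ 2 ≤ 4 * k * (k + 1) * R ^ 2 / s ^ 2 := by
      gcongr; linarith
    have t2 : 2 * n * k / s ≤ 2 * n * k * R ^ 2 / s ^ 2 := by
      rw [div_le_div_iff₀ hx (by positivity)]
      have : 0 ≤ 2 * n * k * s := by positivity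
      nlinarith
    linarith
  exact le_of_mul_le_mul_left (h6.trans (h5.trans h7)) (by positivity)

lemma pos_cube (t : ℝ) : HasDerivAt (fun t : ℝ => (max 0 t) ^ 3) (3 * (max 0 t) ^ 2) t := by
  rcases lt_trichotomy t 0 with h | h | h
  · have e : (fun t : ℝ => (max 0 t) ^ 3) =ᶠ[nhds t] fun _ => 0 := by
      filter_upwards [gt_mem_nhds h] with u hu
      simp [max_eq_left hu.le]
    rw [max_eq_left h.le]
    simpa using (hasDerivAt_const t (0:ℝ)).congr_of_eventuallyEq e
  · subst h
    have : (fun t : ℝ => (max 0 t) ^ 3) =O[nhds 0] fun t => ‖t - 0‖ ^ 3 := by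
      refine Asymptotics.IsBigO.of_bound 1 (Filter.Eventually.of_forall fun u => ?_)
      simp only [sub_zero, norm_pow, one_mul, norm_norm]
      gcongr
      rw [Real.norm_eq_abs, Real.norm_eq_abs, abs_of_nonneg (le_max_left _ _)]
      exact max_le (abs_nonneg _) (le_abs_self _)
    have h := (this.hasFDerivAt (by norm_num)).hasDerivAt
    simpa using h
  · have e : (fun t : ℝ => (max 0 t) ^ 3) =ᶠ[nhds t] fun u => u ^ 3 := by
      filter_upwards [lt_mem_nhds h] with u hu
      simp [max_eq_right hu.le]
    rw [max_eq_right h.le]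
    simpa using (hasDerivAt_pow 3 t).congr_of_eventuallyEq e

/-- kernel -/
noncomputable def ker (n : ℕ) (k : ℕ) (y : EuclideanSpace ℝ (Fin n)) : ℝ :=
  (max 0 (1 - ‖y‖ ^ 2)) ^ k

lemma ker_cont (n k : ℕ) : Continuous (ker n k) := by
  unfold ker; fun_prop

lemma ker_nonneg (n k : ℕ) (y) : 0 ≤ ker n k y := by
  unfold ker; positivity

lemma ker_zero {n k : ℕ} (hk : k ≠ 0) {y : EuclideanSpace ℝ (Fin n)}
    (hy : y ∉ Metric.closedBall (0 : EuclideanSpace ℝ (Fin n)) 1) : ker n k y = 0 := by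
  simp only [Metric.mem_closedBall, dist_zero_right, not_le] at hy
  unfold ker
  rw [max_eq_left (by nlinarith), zero_pow hk]

lemma ker_supp (n : ℕ) {k : ℕ} (hk : k ≠ 0) : HasCompactSupport (ker n k) :=
  HasCompactSupport.intro (isCompact_closedBall 0 1) fun _ hy => ker_zero hk hy

lemma ker_fderiv (n : ℕ) (y : EuclideanSpace ℝ (Fin n)) :
    HasFDerivAt (ker n 3) ((3 * ker n 2 y) • (-((2 : ℝ) • innerSL ℝ y))) y := by
  have h1 : HasFDerivAt (fun y : EuclideanSpace ℝ (Fin n) => 1 - ‖y‖ ^ 2)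
      (-((2 : ℝ) • innerSL ℝ y)) y := by
    have := (hasStrictFDerivAt_norm_sq y).hasFDerivAt.const_sub 1
    refine this.congr_fderiv ?_
    ext; simp
  exact (pos_cube (1 - ‖y‖ ^ 2)).comp_hasFDerivAt y h1

lemma ker_int {n k : ℕ} (hk : k ≠ 0) {f : EuclideanSpace ℝ (Fin n) → ℝ} (hf : Continuous f) :
    MeasureTheory.Integrable (fun y => f y * ker n k y) :=
  (hf.mul (ker_cont n k)).integrable_of_hasCompactSupport ((ker_supp n hk).mul_left)

open MeasureTheory in
lemma mean_deriv_zero {n : ℕ} {v : EuclideanSpace ℝ (Fin n) → ℝ} (hv : ContDiff ℝ (⊤ : ℕ∞) v)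
    (hl : ∀ x, lap v x = 0) (x : EuclideanSpace ℝ (Fin n)) (R : ℝ) :
    ∫ y, fderiv ℝ v (x + R • y) y * ker n 2 y = 0 := by
  have hcf : Continuous (fderiv ℝ v) := hv.continuous_fderiv (by simp)
  let e : Fin n → EuclideanSpace ℝ (Fin n) := fun i => EuclideanSpace.single i 1
  have hpd : ∀ i, ContDiff ℝ (⊤ : ℕ∞) (fun y => fderiv ℝ v y (e i)) := fun i => diff_partial hv (e i)
  have hp : ∀ i, Differentiable ℝ (fun y => fderiv ℝ v y (e i)) := fun i =>
    (hpd i).differentiable (by simp)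
  have hfd : ∀ i y, HasFDerivAt (fun y => fderiv ℝ v (x + R • y) (e i))
      (R • fderiv ℝ (fun y => fderiv ℝ v y (e i)) (x + R • y)) y := by
    intro i y
    have h1 : HasFDerivAt (fun y : EuclideanSpace ℝ (Fin n) => x + R • y)
      (R • ContinuousLinearMap.id ℝ (EuclideanSpace ℝ (Fin n))) y :=
      ((hasFDerivAt_id y).const_smul R).const_add x
    refine ((hp i (x + R • y)).hasFDerivAt.comp y h1).congr_fderiv ?_
    ext; simp
  have hpc : ∀ i, Continuous (fun y => fderiv ℝ v (x + R • y) (e i)) := fun i =>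
    (hpd i).continuous.comp (by fun_prop)
  have hsc : ∀ i, Continuous (fun y => fderiv ℝ (fun y => fderiv ℝ v y (e i)) (x + R • y) (e i)) :=
    fun i => (((hpd i).continuous_fderiv (by simp)).comp (by fun_prop)).clm_apply continuous_const
  have hexp : ∀ y : EuclideanSpace ℝ (Fin n), ∀ L : EuclideanSpace ℝ (Fin n) →L[ℝ] ℝ,
      L y = ∑ i, L (e i) * y i := by
    intro y L
    have hy : y = ∑ i, y i • e i := by
      have := (EuclideanSpace.basisFun (Fin n) ℝ).sum_repr y
      simpa [e] using this.symm
    conv_lhs => rw [hy]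
    simp [map_sum, mul_comm]
  have hker : ∀ i (y : EuclideanSpace ℝ (Fin n)),
      fderiv ℝ (ker n 3) y (e i) = -6 * (y i * ker n 2 y) := by
    intro i y
    rw [(ker_fderiv n y).fderiv]
    simp [e, EuclideanSpace.inner_single_right]
    ring
  have hibp : ∀ i, ∫ y : EuclideanSpace ℝ (Fin n), fderiv ℝ v (x + R • y) (e i) * (y i * ker n 2 y)
      = (R / 6) * ∫ y, fderiv ℝ (fun y => fderiv ℝ v y (e i)) (x + R • y) (e i) * ker n 3 y := by
    intro i
    have h := integral_mul_fderiv_eq_neg_fderiv_mul_of_integrable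
      (μ := (volume : Measure (EuclideanSpace ℝ (Fin n))))
      (f := fun y => fderiv ℝ v (x + R • y) (e i)) (g := ker n 3) (v := e i) ?_ ?_ ?_ ?_ ?_
    · simp only [hker, (hfd i _).fderiv, smul_apply, smul_eq_mul] at h
      have e1 : ∀ y : EuclideanSpace ℝ (Fin n),
        fderiv ℝ v (x + R • y) (e i) * (-6 * (y i * ker n 2 y))
          = -6 * (fderiv ℝ v (x + R • y) (e i) * (y i * ker n 2 y)) := fun y => by ring
      have e2 : ∀ y : EuclideanSpace ℝ (Fin n),
        R * fderiv ℝ (fun y => fderiv ℝ v y (e i)) (x + R • y) (e i) * ker n 3 y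
          = R * (fderiv ℝ (fun y => fderiv ℝ v y (e i)) (x + R • y) (e i) * ker n 3 y) :=
          fun y => by ring
      simp only [e1, e2] at h
      rw [integral_const_mul, integral_const_mul] at h
      linarith
    · simp only [(hfd i _).fderiv, smul_apply, smul_eq_mul]
      exact ker_int (by norm_num) ((hsc i).const_mul R)
    · simp only [hker]
      have : Continuous fun y : EuclideanSpace ℝ (Fin n) =>
          fderiv ℝ v (x + R • y) (e i) * (-6 * y i) := (hpc i).mul (by fun_prop)
      refine (ker_int (k := 2) (by norm_num) this).congr (Filter.Eventually.of_forall fun y => ?_)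
      simp only; ring
    · exact ker_int (by norm_num) (hpc i)
    · exact fun y _ => (hfd i y).differentiableAt
    · exact fun y _ => (ker_fderiv n y).differentiableAt
  have h1 : ∀ y : EuclideanSpace ℝ (Fin n), fderiv ℝ v (x + R • y) y * ker n 2 y
      = ∑ i, fderiv ℝ v (x + R • y) (e i) * (y i * ker n 2 y) := by
    intro y
    rw [hexp y, Finset.sum_mul]
    simp only [mul_assoc]
  simp only [h1]
  rw [integral_finsetSum, Finset.sum_congr rfl fun i _ => hibp i, ← Finset.mul_sum,
    ← integral_finsetSum]
  · have h2 : ∀ y : EuclideanSpace ℝ (Fin n),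
      ∑ i, fderiv ℝ (fun y => fderiv ℝ v y (e i)) (x + R • y) (e i) * ker n 3 y = 0 := by
      intro y
      rw [← Finset.sum_mul]
      have := hl (x + R • y)
      unfold lap at this
      rw [this, zero_mul]
    simp [h2]
  · exact fun i _ => ker_int (by norm_num) (hsc i)
  · intro i _
    have : Continuous fun y : EuclideanSpace ℝ (Fin n) =>
          fderiv ℝ v (x + R • y) (e i) * y i := (hpc i).mul (by fun_prop)
    refine (ker_int (k := 2) (by norm_num) this).congr (Filter.Eventually.of_forall fun y => ?_)
    simp only; ring

open MeasureTheory in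
lemma mean_value {n : ℕ} {v : EuclideanSpace ℝ (Fin n) → ℝ} (hv : ContDiff ℝ (⊤ : ℕ∞) v)
    (hl : ∀ x, lap v x = 0) (x : EuclideanSpace ℝ (Fin n)) (R : ℝ) :
    ∫ y, v (x + R • y) * ker n 2 y = v x * ∫ y, ker n 2 y := by
  have hcf : Continuous (fderiv ℝ v) := hv.continuous_fderiv (by simp)
  have hvd : Differentiable ℝ v := hv.differentiable (by simp)
  have hd : ∀ R : ℝ, HasDerivAt (fun R : ℝ => ∫ y, v (x + R • y) * ker n 2 y) 0 R := by
    intro R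
    rw [← mean_deriv_zero hv hl x R]
    obtain ⟨B, hB⟩ := (isCompact_closedBall x (|R| + 1)).exists_bound_of_continuousOn hcf.continuousOn
    refine (hasDerivAt_integral_of_dominated_loc_of_deriv_le
      (F := fun (R : ℝ) y => v (x + R • y) * ker n 2 y)
      (F' := fun R y => fderiv ℝ v (x + R • y) y * ker n 2 y)
      (bound := fun y => B * ker n 2 y)
      (s := Metric.ball R 1) (Metric.ball_mem_nhds R one_pos) ?_ ?_ ?_ ?_ ?_ ?_).2
    · refine Filter.Eventually.of_forall fun r => ?_
      exact ((hv.continuous.comp (by fun_prop)).mul (ker_cont n 2)).aestronglyMeasurable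
    · exact ker_int (by norm_num) (hv.continuous.comp (by fun_prop))
    · exact (((hcf.comp (by fun_prop)).clm_apply continuous_id).mul (ker_cont n 2)).aestronglyMeasurable
    · refine Filter.Eventually.of_forall fun y r hr => ?_
      by_cases hy : y ∈ Metric.closedBall (0 : EuclideanSpace ℝ (Fin n)) 1
      · rw [norm_mul, Real.norm_of_nonneg (ker_nonneg n 2 y)]
        gcongr
        · exact ker_nonneg n 2 y
        rw [mem_closedBall_zero_iff] at hy
        rw [Metric.mem_ball, Real.dist_eq] at hr
        have hr' : |r| ≤ |R| + 1 := by
          have := abs_sub_abs_le_abs_sub r R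
          linarith
        have hb := hB (x + r • y) (by
          rw [mem_closedBall_iff_norm]
          simp only [add_sub_cancel_left, norm_smul, Real.norm_eq_abs]
          calc |r| * ‖y‖ ≤ (|R| + 1) * 1 := by gcongr
            _ = _ := by ring)
        calc ‖fderiv ℝ v (x + r • y) y‖ ≤ ‖fderiv ℝ v (x + r • y)‖ * ‖y‖ :=
              ContinuousLinearMap.le_opNorm _ _
          _ ≤ B * 1 := by
              gcongr
              exact (norm_nonneg _).trans hb
          _ = B := mul_one B
      · simp [ker_zero (n := n) (k := 2) (by norm_num) hy]
    · exact ker_int (by norm_num) continuous_const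
    · refine Filter.Eventually.of_forall fun y r _ => ?_
      exact (line_deriv1 hvd x y r).mul_const _
  have hc := is_const_of_deriv_eq_zero (fun r => (hd r).differentiableAt) (fun r => (hd r).deriv) R 0
  rw [hc]
  simp only [zero_smul, add_zero]
  rw [integral_const_mul]

open MeasureTheory in
lemma ker_integral_pos (n : ℕ) : 0 < ∫ y, ker n 2 y := by
  refine (ker_cont n 2).integral_pos_of_hasCompactSupport_nonneg_nonzero
    (ker_supp n (by norm_num)) (fun y => ker_nonneg n 2 y) (x := 0) ?_
  simp [ker]

open MeasureTheory in
lemma mean_cov {n : ℕ} (v : EuclideanSpace ℝ (Fin n) → ℝ) (x : EuclideanSpace ℝ (Fin n)) {R : ℝ}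
    (hR : 0 < R) :
    ∫ z, v z * ker n 2 (R⁻¹ • (z - x)) = R ^ n * ∫ y, v (x + R • y) * ker n 2 y := by
  have h := Measure.integral_comp_inv_smul_of_nonneg
    (volume : Measure (EuclideanSpace ℝ (Fin n)))
    (fun y => v (x + R • y) * ker n 2 y) hR.le
  simp only [smul_inv_smul₀ hR.ne', finrank_euclideanSpace, Fintype.card_fin, smul_eq_mul] at h
  rw [← h, ← integral_sub_right_eq_self (fun y => v (x + y) * ker n 2 (R⁻¹ • y)) x]
  simp

open MeasureTheory in
lemma harnack {n : ℕ} {v : EuclideanSpace ℝ (Fin n) → ℝ} (hv : ContDiff ℝ (⊤ : ℕ∞) v)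
    (hpos : ∀ x, 0 < v x) (hl : ∀ x, lap v x = 0) (x w : EuclideanSpace ℝ (Fin n)) {R : ℝ}
    (hR : 0 < R) : v x ≤ ((R + ‖x - w‖) / R) ^ (n + 4) * v w := by
  set d := ‖x - w‖ with hd
  have hd0 : 0 ≤ d := norm_nonneg _
  set R' := R + d with hR'
  have hR'0 : 0 < R' := by positivity
  have hc := ker_integral_pos n
  have h1 := mean_cov v x hR
  have h2 := mean_cov v w hR'0
  rw [mean_value hv hl] at h1 h2
  have hint : ∀ (p : EuclideanSpace ℝ (Fin n)) (r : ℝ), 0 < r →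
      Integrable (fun z => v z * ker n 2 (r⁻¹ • (z - p))) := by
    intro p r hr
    refine (hv.continuous.mul ((ker_cont n 2).comp (by fun_prop))).integrable_of_hasCompactSupport ?_
    refine HasCompactSupport.intro (isCompact_closedBall p r) fun z hz => ?_
    change v z * ker n 2 (r⁻¹ • (z - p)) = 0
    rw [ker_zero (by norm_num), mul_zero]
    rw [mem_closedBall_iff_norm] at hz
    rw [mem_closedBall_zero_iff, norm_smul, norm_inv, Real.norm_of_nonneg hr.le]
    rw [inv_mul_le_iff₀ hr, mul_one]
    exact hz
  have hkk : ∀ z, ker n 2 (R⁻¹ • (z - x)) ≤ (R' / R) ^ 4 * ker n 2 (R'⁻¹ • (z - w)) := by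
    intro z
    unfold ker
    have : (R' / R) ^ 4 * (max 0 (1 - ‖R'⁻¹ • (z - w)‖ ^ 2)) ^ 2
      = ((R' / R) ^ 2 * (max 0 (1 - ‖R'⁻¹ • (z - w)‖ ^ 2))) ^ 2 := by ring
    rw [this]
    refine pow_le_pow_left₀ (le_max_left _ _) ?_ 2
    by_cases hz : ‖z - x‖ ≤ R
    · have hq : 1 - ‖R⁻¹ • (z - x)‖ ^ 2 ≤ (R' / R) ^ 2 * (1 - ‖R'⁻¹ • (z - w)‖ ^ 2) := by
        simp only [norm_smul, norm_inv, Real.norm_of_nonneg hR.le, Real.norm_of_nonneg hR'0.le]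
        have e1 : (R' / R) ^ 2 * (1 - (R'⁻¹ * ‖z - w‖) ^ 2) = (R' ^ 2 - ‖z - w‖ ^ 2) / R ^ 2 := by
          field_simp
        have e2 : 1 - (R⁻¹ * ‖z - x‖) ^ 2 = (R ^ 2 - ‖z - x‖ ^ 2) / R ^ 2 := by
          field_simp
        rw [e1, e2]
        gcongr ?_ / _
        have h3 : ‖z - w‖ ≤ ‖z - x‖ + d := by
          rw [hd]
          calc ‖z - w‖ = ‖(z - x) + (x - w)‖ := by congr 1; abel
            _ ≤ _ := norm_add_le _ _
        have h4 : ‖z - w‖ ^ 2 ≤ (‖z - x‖ + d) ^ 2 := by gcongr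
        rw [hR']
        nlinarith [mul_le_mul_of_nonneg_right hz hd0]
      refine max_le (by positivity) (hq.trans ?_)
      gcongr
      exact le_max_right _ _
    · push Not at hz
      rw [max_eq_left]
      · positivity
      · simp only [norm_smul, norm_inv, Real.norm_of_nonneg hR.le]
        have : 1 < R⁻¹ * ‖z - x‖ := by
          rw [lt_inv_mul_iff₀ hR]; linarith
        nlinarith
  have hmono : ∫ z, v z * ker n 2 (R⁻¹ • (z - x))
      ≤ ∫ z, (R' / R) ^ 4 * (v z * ker n 2 (R'⁻¹ • (z - w))) := by
    refine integral_mono (hint x R hR) ((hint w R' hR'0).const_mul _) fun z => ?_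
    have := mul_le_mul_of_nonneg_left (hkk z) (hpos z).le
    simp only
    linarith
  rw [integral_const_mul, h1, h2] at hmono
  have h5 : (∫ y, ker n 2 y) * R ^ n * v x
     ≤ (∫ y, ker n 2 y) * R ^ n * ((R' / R) ^ (n + 4) * v w) := by
    refine le_trans (le_of_eq (by ring)) (hmono.trans (le_of_eq ?_))
    rw [pow_add, div_pow R' R n]
    field_simp
  exact le_of_mul_le_mul_left h5 (by positivity)

lemma harmonic_const {n : ℕ} {v : EuclideanSpace ℝ (Fin n) → ℝ} (hv : ContDiff ℝ (⊤ : ℕ∞) v)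
    (hpos : ∀ x, 0 < v x) (hl : ∀ x, lap v x = 0) (x w : EuclideanSpace ℝ (Fin n)) :
    v x ≤ v w := by
  have ht : Filter.Tendsto (fun R : ℝ => (1 + ‖x - w‖ / R) ^ (n + 4) * v w) Filter.atTop
      (nhds ((1 + 0) ^ (n + 4) * v w)) :=
    ((tendsto_const_nhds.add (tendsto_const_nhds.div_atTop Filter.tendsto_id)).pow _).mul_const _
  simp only [add_zero, one_pow, one_mul] at ht
  refine ge_of_tendsto ht ?_
  filter_upwards [Filter.eventually_gt_atTop 0] with R hR
  have h := harnack hv hpos hl x w hR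
  rwa [add_div, div_self hR.ne'] at h

theorem stmt_6 (n : ℕ) (hn : 3 ≤ n) (μ a b : ℝ)
    (hμ : 0 ≤ μ) (ha : a ≤ 0) (hb : 0 ≤ b)
    (v : EuclideanSpace ℝ (Fin n) → ℝ) (hv : ContDiff ℝ (⊤ : ℕ∞) v)
    (hpos : ∀ x, 0 < v x)
    (heq : ∀ x, lap v x + μ * v x + a * v x ^ (((n : ℝ) + 2) / ((n : ℝ) - 2))
        + b * v x ^ (-(3 * (n : ℝ) - 2) / ((n : ℝ) - 2)) = 0) :
    ∀ x y, v x = v y := by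
  have hn' : (3 : ℝ) ≤ n := by exact_mod_cast hn
  have hn2 : (0 : ℝ) < n - 2 := by linarith
  set α : ℝ := 4 / (n - 2) with hα
  set β : ℝ := (4 * n - 4) / (n - 2) with hβ
  set k : ℝ := (n - 2) / 2 with hk
  have hα0 : 0 < α := by positivity
  have hβ0 : 0 < β := div_pos (by linarith) hn2
  have hk0 : 0 < k := by positivity
  have hkα : k * α = 2 := by rw [hk, hα]; field_simp; norm_num
  have e1 : ((n : ℝ) + 2) / ((n : ℝ) - 2) = α + 1 := by rw [hα]; field_simp; ring
  have e2 : -(3 * (n : ℝ) - 2) / ((n : ℝ) - 2) = -β + 1 := by rw [hβ]; field_simp; ring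
  have heq' : ∀ x, lap v x = v x * gfun μ a b α β (v x) := by
    intro x
    have h := heq x
    rw [e1, e2, Real.rpow_add_one (hpos x).ne', Real.rpow_add_one (hpos x).ne'] at h
    unfold gfun
    linarith
  have htend : ∀ C : ℝ, Filter.Tendsto (fun R : ℝ => C / R ^ 2) Filter.atTop (nhds 0) := fun C =>
    tendsto_const_nhds.div_atTop (Filter.tendsto_pow_atTop two_ne_zero)
  have hlow : ∀ x, 0 ≤ gfun μ a b α β (v x) := by
    intro x
    refine le_of_tendsto (htend (-(((n : ℝ) + 2) ^ 2 / 2))) ?_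
    filter_upwards [Filter.eventually_gt_atTop 0] with R hR
    exact lower hv hpos (fun V W hV hVW => gfun_mono ha hb hα0 hβ0 hV hVW) heq' x hR
  have hup : ∀ x, gfun μ a b α β (v x) ≤ 0 := by
    intro x
    refine ge_of_tendsto (htend (4 * k * (k + 1) + 2 * n * k)) ?_
    filter_upwards [Filter.eventually_gt_atTop 0] with R hR
    exact upper hv hpos hμ ha hb hα0 hβ0 hk0 hkα heq' x hR
  have hg : ∀ x, gfun μ a b α β (v x) = 0 := fun x => le_antisymm (hup x) (hlow x)
  intro x y
  have hl : ∀ x, lap v x = 0 := fun x => by rw [heq', hg, mul_zero]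
  exact le_antisymm (harmonic_const hv hpos hl x y) (harmonic_const hv hpos hl y x)
end
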